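/- arXiv:1101.2148 — 6 statements merged into one kernel-verified Lean document; each statement's English description precedes it below -/
import Mathlib

section
/- Let n ≥ 1 and let f : {1,−1}^n → ℝ. For 1 ≤ j ≤ n let I_j = f|_{ε_j=1} − f|_{ε_j=−1} denote the j-th influence (a function of the variables ε_{j'}, j' ≠ j). Assume I_j ≥ 0 for every j (f is monotone increasing in each coordinate), and that there is κ > 0 and, for each j, subsets Ω_j, Ω_j' ⊆ {1,−1}^n, where Ω_j depends only on the variables ε_1,…,ε_{j−1} and Ω_j' depends only on ε_{j+1},…,ε_n, such that I_j ≥ κ on Ω_j ∩ Ω_j'. Then there is an absolute constant C such that for every t ∈ ℝ, mes[ ε : |f(ε) − t| < κ/2 ] ≤ C/√n + Σ_{j=1}^n (2 − mes Ω_j − mes Ω_j'). -/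
noncomputable section

/-- Uniform measure of a subset of the Boolean cube `{1,-1}^n`
(encoded as `Fin n → Bool`, with `true ↔ 1` and `false ↔ -1`). -/
def mes {n : ℕ} (S : Set (Fin n → Bool)) : ℝ := by
  classical exact ((Finset.univ.filter fun ε => ε ∈ S).card : ℝ) / 2 ^ n

/-- The `j`-th influence of `f : {1,-1}^n → ℝ`:
`I_j(ε) = f|_{ε_j = 1} - f|_{ε_j = -1}` (a function of the other variables). -/
def influence {n : ℕ} (f : (Fin n → Bool) → ℝ) (j : Fin n) (ε : Fin n → Bool) : ℝ :=
  f (Function.update ε j true) - f (Function.update ε j false)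

/-- `S ⊆ {1,-1}^n` depends only on the variables `ε_k` for `k < j`. -/
def DependsOnLt {n : ℕ} (S : Set (Fin n → Bool)) (j : Fin n) : Prop :=
  ∀ ε ε' : Fin n → Bool, (∀ k : Fin n, k < j → ε k = ε' k) → (ε ∈ S ↔ ε' ∈ S)

/-- `S ⊆ {1,-1}^n` depends only on the variables `ε_k` for `k > j`. -/
def DependsOnGt {n : ℕ} (S : Set (Fin n → Bool)) (j : Fin n) : Prop :=
  ∀ ε ε' : Fin n → Bool, (∀ k : Fin n, j < k → ε k = ε' k) → (ε ∈ S ↔ ε' ∈ S)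

theorem two_mul_add_one_mul_centralBinom_sq_le (m : ℕ) :
    (2 * m + 1) * m.centralBinom ^ 2 ≤ 16 ^ m := by
  induction m with
  | zero => simp
  | succ m ih =>
    have h := Nat.succ_mul_centralBinom_succ m
    refine le_of_mul_le_mul_left (a := (m + 1) ^ 2) ?_ (pow_pos m.succ_pos 2)
    calc (m + 1) ^ 2 * ((2 * (m + 1) + 1) * (m + 1).centralBinom ^ 2)
        = (2 * m + 3) * ((m + 1) * (m + 1).centralBinom) ^ 2 := by ring
      _ = 4 * ((2 * m + 3) * (2 * m + 1)) * ((2 * m + 1) * m.centralBinom ^ 2) := by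
          rw [h]; ring
      _ ≤ 4 * (4 * (m + 1) ^ 2) * 16 ^ m :=
          Nat.mul_le_mul (Nat.mul_le_mul_left 4 (by nlinarith)) ih
      _ = (m + 1) ^ 2 * 16 ^ (m + 1) := by ring

theorem mul_choose_half_sq_le (n : ℕ) : n * n.choose (n / 2) ^ 2 ≤ 4 ^ n := by
  rcases Nat.even_or_odd' n with ⟨m, rfl | rfl⟩
  · have h := two_mul_add_one_mul_centralBinom_sq_le m
    rw [Nat.mul_div_cancel_left m two_pos, ← Nat.centralBinom_eq_two_mul_choose, pow_mul]
    norm_num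
    nlinarith [sq_nonneg m.centralBinom]
  · have h := two_mul_add_one_mul_centralBinom_sq_le (m + 1)
    have hc : (m + 1).centralBinom = 2 * (2 * m + 1).choose m := by
      rw [Nat.centralBinom_eq_two_mul_choose, show 2 * (m + 1) = 2 * m + 1 + 1 by ring,
        Nat.choose_succ_succ, Nat.choose_symm_half]
      ring
    have hp : (16 : ℕ) ^ (m + 1) = 4 * 4 ^ (2 * m + 1) := by
      rw [pow_succ 4 (2 * m), pow_mul]
      norm_num
      ring
    rw [hc, hp] at h
    rw [show (2 * m + 1) / 2 = m by omega]
    nlinarith [sq_nonneg ((2 * m + 1).choose m)]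

theorem choose_half_div_two_pow_le {n : ℕ} (hn : 1 ≤ n) :
    (n.choose (n / 2) : ℝ) / 2 ^ n ≤ 1 / √n := by
  have hs : 0 < √(n : ℝ) := Real.sqrt_pos.2 (by exact_mod_cast hn)
  rw [div_le_div_iff₀ (by positivity) hs, one_mul]
  refine le_of_sq_le_sq ?_ (by positivity)
  rw [mul_pow, Real.sq_sqrt n.cast_nonneg, ← pow_mul, mul_comm n 2, pow_mul, mul_comm]
  norm_num
  exact_mod_cast mul_choose_half_sq_le n

variable {n : ℕ}

theorem mes_eq_ncard_div (S : Set (Fin n → Bool)) : mes S = S.ncard / 2 ^ n := by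
  classical
  rw [mes, Set.ncard_eq_toFinset_card']
  congr
  ext
  simp

theorem mes_mono {S T : Set (Fin n → Bool)} (h : S ⊆ T) : mes S ≤ mes T := by
  rw [mes_eq_ncard_div, mes_eq_ncard_div]
  gcongr
  exact T.toFinite

theorem mes_union_le (S T : Set (Fin n → Bool)) : mes (S ∪ T) ≤ mes S + mes T := by
  simp only [mes_eq_ncard_div]
  rw [← add_div]
  gcongr
  exact_mod_cast Set.ncard_union_le S T

theorem mes_compl (S : Set (Fin n → Bool)) : mes Sᶜ = 1 - mes S := by
  have h : (S.ncard + Sᶜ.ncard : ℝ) = 2 ^ n := by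
    exact_mod_cast (Set.ncard_add_ncard_compl S).trans (by simp)
  rw [mes_eq_ncard_div, mes_eq_ncard_div]
  field_simp
  linarith

theorem mes_biUnion_le {ι : Type*} (s : Finset ι) (S : ι → Set (Fin n → Bool)) :
    mes (⋃ i ∈ s, S i) ≤ ∑ i ∈ s, mes (S i) := by
  classical
  induction s using Finset.induction_on with
  | empty => simp [mes_eq_ncard_div]
  | insert i s hi ih =>
    rw [Finset.set_biUnion_insert, Finset.sum_insert hi]
    exact (mes_union_le _ _).trans (by gcongr)

/-- Sperner's theorem for antichains of the Boolean cube. -/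
theorem IsAntichain.mes_le (hn : 1 ≤ n) {A : Set (Fin n → Bool)} (hA : IsAntichain (· ≤ ·) A) :
    mes A ≤ 1 / √n := by
  classical
  let F : (Fin n → Bool) → Finset (Fin n) := fun ε => {j | ε j = true}
  have hF (ε ε' : Fin n → Bool) : F ε ⊆ F ε' ↔ ε ≤ ε' := by
    simp [F, Finset.subset_iff, Pi.le_def, Bool.le_iff_imp]
  have hinj : F.Injective := fun ε ε' h =>
    le_antisymm ((hF _ _).1 h.le) ((hF _ _).1 h.ge)
  have hanti : IsAntichain (· ⊆ ·) (SetLike.coe (A.toFinset.image F)) := by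
    rw [Finset.coe_image, Set.coe_toFinset]
    rintro _ ⟨ε, hε, rfl⟩ _ ⟨ε', hε', rfl⟩ hne h
    exact hA hε hε' (fun h => hne (congrArg F h)) ((hF _ _).1 h)
  have hcard := hanti.sperner
  rw [Finset.card_image_of_injective _ hinj, ← Set.ncard_eq_toFinset_card', Fintype.card_fin]
    at hcard
  refine le_trans ?_ (choose_half_div_two_pow_le hn)
  rw [mes_eq_ncard_div]
  gcongr

theorem monotone_of_influence_nonneg {f : (Fin n → Bool) → ℝ}
    (hf : ∀ j ε, 0 ≤ influence f j ε) : Monotone f := by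
  classical
  intro ε ε' h
  have key (s : Finset (Fin n)) : f ε ≤ f (s.piecewise ε' ε) := by
    induction s using Finset.induction_on with
    | empty => simp
    | insert j s hj ih =>
      rw [Finset.piecewise_insert]
      refine ih.trans ?_
      have hη : s.piecewise ε' ε = Function.update (s.piecewise ε' ε) j (ε j) := by
        simp [hj]
      have hinf := hf j (s.piecewise ε' ε)
      have hj' := h j
      rw [influence, sub_nonneg] at hinf
      conv_lhs => rw [hη]
      rcases hε : ε j <;> rcases hε' : ε' j <;> rw [hε, hε'] at hj'
      exacts [hinf, absurd hj' (by simp)]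
  simpa using key Finset.univ

/-- Points of a chain in `⋂ j, Ω j ∩ Ω' j` are separated by `κ` under `f`. -/
theorem add_le_of_lt_of_mem {f : (Fin n → Bool) → ℝ} {κ : ℝ} {Ω Ω' : Fin n → Set (Fin n → Bool)}
    (hf : Monotone f) (hΩ : ∀ j, DependsOnLt (Ω j) j) (hΩ' : ∀ j, DependsOnGt (Ω' j) j)
    (hκ : ∀ j ε, ε ∈ Ω j ∩ Ω' j → κ ≤ influence f j ε) {ε ε' : Fin n → Bool} (h : ε < ε')
    (hε : ∀ j, ε ∈ Ω j) (hε' : ∀ j, ε' ∈ Ω' j) : f ε + κ ≤ f ε' := by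
  obtain ⟨hle, j, hj⟩ := Pi.lt_def.1 h
  obtain ⟨hj₀, hj₁⟩ := Bool.lt_iff.1 hj
  let η : Fin n → Bool := fun k => if k < j then ε k else ε' k
  have hη : η ∈ Ω j ∩ Ω' j :=
    ⟨(hΩ j η ε fun k hk => if_pos hk).2 (hε j),
      (hΩ' j η ε' fun k hk => if_neg hk.not_gt).2 (hε' j)⟩
  have h₀ : f ε ≤ f (Function.update η j false) := by
    refine hf (le_update_iff.2 ⟨hj₀.le, fun k _ => ?_⟩)
    dsimp only [η]
    split_ifs
    exacts [le_rfl, hle k]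
  have h₁ : f (Function.update η j true) ≤ f ε' := by
    refine hf (update_le_iff.2 ⟨hj₁.ge, fun k _ => ?_⟩)
    dsimp only [η]
    split_ifs
    exacts [hle k, le_rfl]
  have := hκ j η hη
  rw [influence] at this
  linarith

/-- **Lemma 1.** If `f` on the cube is monotone (all influences nonnegative) and
`I_j ≥ κ` on `Ω_j ∩ Ω_j'`, where `Ω_j` depends only on `ε_1,…,ε_{j-1}` and `Ω_j'`
only on `ε_{j+1},…,ε_n`, then for every `t`,
`mes[|f - t| < κ/2] ≤ C/√n + Σ_j (2 - mes Ω_j - mes Ω_j')`. -/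
theorem sperner_anticoncentration :
    ∃ C : ℝ, 0 < C ∧
      ∀ (n : ℕ), 1 ≤ n →
        ∀ (f : (Fin n → Bool) → ℝ) (κ : ℝ), 0 < κ →
          ∀ (Ω Ω' : Fin n → Set (Fin n → Bool)),
            (∀ (j : Fin n) (ε : Fin n → Bool), 0 ≤ influence f j ε) →
            (∀ j : Fin n, DependsOnLt (Ω j) j) →
            (∀ j : Fin n, DependsOnGt (Ω' j) j) →
            (∀ (j : Fin n) (ε : Fin n → Bool), ε ∈ Ω j ∩ Ω' j → κ ≤ influence f j ε) →
            ∀ t : ℝ,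
              mes {ε : Fin n → Bool | |f ε - t| < κ / 2} ≤
                C / Real.sqrt n + ∑ j : Fin n, (2 - mes (Ω j) - mes (Ω' j)) := by
  refine ⟨1, one_pos, fun n hn f κ _ Ω Ω' hf hΩ hΩ' hκ t => ?_⟩
  have hmono := monotone_of_influence_nonneg hf
  set A := {ε : Fin n → Bool | |f ε - t| < κ / 2}
  set G : Set (Fin n → Bool) := {ε | ∀ j, ε ∈ Ω j ∩ Ω' j}
  have hanti : IsAntichain (· ≤ ·) (A ∩ G) := by
    rintro ε ⟨hεA, hεG⟩ ε' ⟨hεA', hεG'⟩ hne hle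
    have hsep := add_le_of_lt_of_mem hmono hΩ hΩ' hκ (lt_of_le_of_ne hle hne)
      (fun j => (hεG j).1) (fun j => (hεG' j).2)
    have h₁ : |f ε - t| < κ / 2 := hεA
    have h₂ : |f ε' - t| < κ / 2 := hεA'
    rw [abs_lt] at h₁ h₂
    linarith [h₁.1, h₂.2]
  have hcover : A ⊆ (A ∩ G) ∪ ⋃ j ∈ Finset.univ, (Ω j)ᶜ ∪ (Ω' j)ᶜ := by
    intro ε hε
    by_cases hG : ε ∈ G
    · exact Or.inl ⟨hε, hG⟩
    · right
      obtain ⟨j, hj⟩ := not_forall.1 hG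
      simp only [Finset.mem_univ, Set.iUnion_true, Set.mem_iUnion]
      exact ⟨j, by rwa [← Set.compl_inter]⟩
  calc mes A ≤ mes (A ∩ G) + mes (⋃ j ∈ Finset.univ, (Ω j)ᶜ ∪ (Ω' j)ᶜ) :=
        (mes_mono hcover).trans (mes_union_le _ _)
    _ ≤ 1 / √n + ∑ j, mes ((Ω j)ᶜ ∪ (Ω' j)ᶜ) := by
        gcongr
        exacts [hanti.mes_le hn, mes_biUnion_le _ _]
    _ ≤ 1 / √n + ∑ j, (2 - mes (Ω j) - mes (Ω' j)) := by
        gcongr with j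
        refine (mes_union_le _ _).trans ?_
        rw [mes_compl, mes_compl]
        linarith
end
end

section
/- Fix λ > 0 and E ∈ ℝ, and for ε ∈ [−1,1] let g_E(ε) = [[E − λε, −1],[1,0]] ∈ SL₂(ℝ). Then for every θ, the map ε ↦ τ_{g_E(ε)}(θ) is differentiable with ∂_ε τ_{g_E(ε)}(θ) = λ · sin² τ_{g_E(ε)}(θ) = λ cos²θ / ( cos²θ + ((E − λε) cos θ − sin θ)² ); in particular ∂_ε τ_{g_E(ε)}(θ) ≥ 0. -/
noncomputable section

/-- The unit complex number `e^{i τ_g(θ)}` defining the projective action of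
`g = [[a,b],[c,d]]` on the circle. -/
def projPoint (a b c d θ : ℝ) : ℂ :=
  ((a * Real.cos θ + b * Real.sin θ : ℝ) +
      Complex.I * (c * Real.cos θ + d * Real.sin θ : ℝ)) /
    (Real.sqrt ((a * Real.cos θ + b * Real.sin θ) ^ 2 +
      (c * Real.cos θ + d * Real.sin θ) ^ 2) : ℝ)

/-- A continuous angle function whose sine, measured from the base value `τ a`, is differentiable
at `a` is itself differentiable at `a`, with the same derivative. -/
theorem HasDerivWithinAt.of_sin_sub {τ : ℝ → ℝ} {s : Set ℝ} {a τ' : ℝ}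
    (hcont : ContinuousWithinAt τ s a)
    (hsin : HasDerivWithinAt (fun x => Real.sin (τ x - τ a)) τ' s a) :
    HasDerivWithinAt τ τ' s a := by
  have harcsin : HasDerivAt Real.arcsin 1 (Real.sin (τ a - τ a)) := by
    simpa using Real.hasDerivAt_arcsin (x := 0) (by norm_num) (by norm_num)
  have hcomp := (harcsin.comp_hasDerivWithinAt a hsin).const_add (τ a)
  rw [one_mul] at hcomp
  refine hcomp.congr_of_eventuallyEq ?_ (by simp)
  have hsub : Filter.Tendsto (fun x => τ x - τ a) (nhdsWithin a s) (nhds 0) := by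
    simpa using hcont.tendsto.sub_const (τ a)
  have hnear : ∀ᶠ x in nhdsWithin a s,
      τ x - τ a ∈ Set.Icc (-(Real.pi / 2)) (Real.pi / 2) :=
    hsub (Icc_mem_nhds (by linarith [Real.pi_pos]) (by linarith [Real.pi_pos]))
  filter_upwards [hnear] with x hx
  simp [Real.arcsin_sin hx.1 hx.2]

/-- Cosine and sine of an angle representing `projPoint a b c d θ`. -/
theorem cos_sin_of_exp_eq_projPoint {a b c d θ t : ℝ}
    (h : Complex.exp (Complex.I * t) = projPoint a b c d θ) :
    Real.cos t = (a * Real.cos θ + b * Real.sin θ) /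
        Real.sqrt ((a * Real.cos θ + b * Real.sin θ) ^ 2 +
          (c * Real.cos θ + d * Real.sin θ) ^ 2) ∧
      Real.sin t = (c * Real.cos θ + d * Real.sin θ) /
        Real.sqrt ((a * Real.cos θ + b * Real.sin θ) ^ 2 +
          (c * Real.cos θ + d * Real.sin θ) ^ 2) := by
  rw [mul_comm, projPoint] at h
  constructor
  · have hre := congrArg Complex.re h
    rw [Complex.exp_ofReal_mul_I_re, Complex.div_ofReal_re, Complex.add_re,
      Complex.ofReal_re, Complex.re_mul_ofReal] at hre
    simpa using hre
  · have him := congrArg Complex.im h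
    rw [Complex.exp_ofReal_mul_I_im, Complex.div_ofReal_im, Complex.add_im,
      Complex.ofReal_im, Complex.im_mul_ofReal] at him
    simpa using him

/-- For the Anderson–Bernoulli single-step matrix `g_E(ε) = [[E - λε, -1],[1,0]]`
and fixed `θ`, any continuous lift `ε ↦ τ(ε)` of `ε ↦ τ_{g_E(ε)}(θ)` on `[-1,1]`
is differentiable with
`∂_ε τ = λ sin² τ_{g_E(ε)}(θ) = λ cos²θ / (cos²θ + ((E - λε) cosθ - sinθ)²) ≥ 0`. -/
theorem single_step_eps_deriv
    (lam E θ : ℝ) (hlam : 0 < lam)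
    (τ : ℝ → ℝ) (hτcont : ContinuousOn τ (Set.Icc (-1) 1))
    (hτ : ∀ ε ∈ Set.Icc (-1 : ℝ) 1,
      Complex.exp (Complex.I * τ ε) = projPoint (E - lam * ε) (-1) 1 0 θ) :
    ∀ ε ∈ Set.Icc (-1 : ℝ) 1,
      HasDerivWithinAt τ (lam * Real.sin (τ ε) ^ 2) (Set.Icc (-1) 1) ε ∧
      lam * Real.sin (τ ε) ^ 2 =
        lam * Real.cos θ ^ 2 /
          (Real.cos θ ^ 2 + ((E - lam * ε) * Real.cos θ - Real.sin θ) ^ 2) ∧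
      0 ≤ lam * Real.sin (τ ε) ^ 2 := by
  intro ε hε
  set x : ℝ → ℝ := fun e => (E - lam * e) * Real.cos θ - Real.sin θ with hx
  set y : ℝ := Real.cos θ with hy
  set r : ℝ → ℝ := fun e => Real.sqrt (x e ^ 2 + y ^ 2) with hr
  have hpos : ∀ e, 0 < x e ^ 2 + y ^ 2 := by
    intro e
    by_cases hy0 : y = 0
    · have hsin : Real.sin θ ^ 2 = 1 := by
        have := Real.sin_sq_add_cos_sq θ
        rw [← hy, hy0] at this
        linarith
      simp [hx, hy0, hsin]
    · positivity
  have hrpos : ∀ e, 0 < r e := fun e => Real.sqrt_pos.2 (hpos e)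
  have hcos_sin : ∀ e ∈ Set.Icc (-1 : ℝ) 1,
      Real.cos (τ e) = x e / r e ∧ Real.sin (τ e) = y / r e := by
    intro e he
    simpa [hx, hr, ← sub_eq_add_neg] using cos_sin_of_exp_eq_projPoint (hτ e he)
  have hsq : Real.sin (τ ε) ^ 2 = y ^ 2 / (x ε ^ 2 + y ^ 2) := by
    rw [(hcos_sin ε hε).2, div_pow, Real.sq_sqrt (hpos ε).le]
  refine ⟨?_, ?_, by positivity⟩
  · apply HasDerivWithinAt.of_sin_sub (hτcont ε hε)
    have hxder : HasDerivAt x (-lam * y) ε := by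
      refine HasDerivAt.congr_deriv
        (((((hasDerivAt_id ε).const_mul lam).const_sub E).mul_const y).sub_const (Real.sin θ)) ?_
      ring
    have hrder : HasDerivAt r _ ε :=
      ((hxder.pow 2).add_const (y ^ 2)).sqrt (hpos ε).ne'
    have hquot := ((hxder.const_sub (x ε)).const_mul y).div (hrder.mul_const (r ε))
      (mul_pos (hrpos ε) (hrpos ε)).ne'
    have hval : lam * Real.sin (τ ε) ^ 2 = y * (lam * y) / (r ε * r ε) := by
      rw [(hcos_sin ε hε).2]
      ring
    have hquot' : HasDerivAt (fun e => y * (x ε - x e) / (r e * r ε))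
        (lam * Real.sin (τ ε) ^ 2) ε := by
      refine hquot.congr_deriv ?_
      rw [hval]
      have := (hrpos ε).ne'
      simp only [sub_self, mul_zero, zero_mul, sub_zero]
      field_simp
    refine hquot'.hasDerivWithinAt.congr_of_mem (fun e he => ?_) hε
    rw [Real.sin_sub, (hcos_sin e he).1, (hcos_sin e he).2, (hcos_sin ε hε).1,
      (hcos_sin ε hε).2]
    have := (hrpos ε).ne'
    have := (hrpos e).ne'
    field_simp
  · rw [hsq, add_comm, mul_div_assoc]
end
end

section
/- For every B > 0 there is a constant c > 0 such that for every a ∈ ℝ with |a| ≤ B, setting g = [[a, −1],[1, 0]] ∈ SL₂(ℝ), one has |cos θ| + |cos τ_g(θ)| ≥ c for all θ. -/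
noncomputable section

lemma projPoint_re (a b c d θ : ℝ) :
    (projPoint a b c d θ).re = (a * Real.cos θ + b * Real.sin θ) /
      Real.sqrt ((a * Real.cos θ + b * Real.sin θ) ^ 2 +
        (c * Real.cos θ + d * Real.sin θ) ^ 2) := by
  rw [projPoint, Complex.div_ofReal_re, Complex.add_re, Complex.re_mul_ofReal, Complex.I_re,
    zero_mul, add_zero, Complex.ofReal_re]

lemma sqrt_sq_add_sq_le_abs_add_abs (x y : ℝ) : Real.sqrt (x ^ 2 + y ^ 2) ≤ |x| + |y| := by
  refine Real.sqrt_le_iff.mpr ⟨by positivity, ?_⟩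
  nlinarith [sq_abs x, sq_abs y, mul_nonneg (abs_nonneg x) (abs_nonneg y)]

lemma one_le_abs_cos_add_abs_sin (θ : ℝ) : 1 ≤ |Real.cos θ| + |Real.sin θ| := by
  simpa using sqrt_sq_add_sq_le_abs_add_abs (Real.cos θ) (Real.sin θ)

/-- For every `B > 0` there is `c > 0` such that for `g = [[a,-1],[1,0]]` with
`|a| ≤ B` one has `|cos θ| + |cos τ_g(θ)| ≥ c` for all `θ`; here `τ_g(θ)` is any
real number with `e^{i τ_g(θ)}` equal to the defining unit complex number of the
projective action. -/
theorem cos_theta_add_cos_tau_lower_bound :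
    ∀ B : ℝ, 0 < B →
      ∃ c : ℝ, 0 < c ∧
        ∀ a : ℝ, |a| ≤ B →
          ∀ θ τv : ℝ,
            Complex.exp (Complex.I * τv) = projPoint a (-1) 1 0 θ →
            c ≤ |Real.cos θ| + |Real.cos τv| := by
  intro B hB
  refine ⟨1 / (B + 2), by positivity, fun a ha θ τv h ↦ ?_⟩
  have hcos : Real.cos τv = (projPoint a (-1) 1 0 θ).re := by
    rw [← h, mul_comm, Complex.exp_ofReal_mul_I_re]
  rw [projPoint_re] at hcos
  set x := a * Real.cos θ + -1 * Real.sin θ with hx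
  set y := 1 * Real.cos θ + 0 * Real.sin θ with hy
  have hyc : y = Real.cos θ := by rw [hy]; ring
  have hac : |a * Real.cos θ| ≤ B * |Real.cos θ| := by
    rw [abs_mul]
    gcongr
  have hsin : |Real.sin θ| ≤ B * |Real.cos θ| + |x| := by
    have : Real.sin θ = a * Real.cos θ - x := by rw [hx]; ring
    rw [this]
    exact (abs_sub _ _).trans (by gcongr)
  have hxB : |x| ≤ B + 1 := by
    have hc : B * |Real.cos θ| ≤ B := mul_le_of_le_one_right hB.le (Real.abs_cos_le_one θ)
    have := abs_add_le (a * Real.cos θ) (-1 * Real.sin θ)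
    rw [← hx, neg_one_mul, abs_neg] at this
    linarith [Real.abs_sin_le_one θ]
  have hN : Real.sqrt (x ^ 2 + y ^ 2) ≤ B + 2 := by
    have := sqrt_sq_add_sq_le_abs_add_abs x y
    rw [hyc] at this ⊢
    linarith [Real.abs_cos_le_one θ]
  have hpos : 0 < Real.sqrt (x ^ 2 + y ^ 2) := by
    refine Real.sqrt_pos.mpr ((by positivity : 0 ≤ x ^ 2 + y ^ 2).lt_of_ne' fun h0 ↦ ?_)
    have hx0 : x = 0 := by nlinarith [sq_nonneg x, sq_nonneg y]
    have hy0 : Real.cos θ = 0 := by rw [← hyc]; nlinarith [sq_nonneg x, sq_nonneg y]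
    have := one_le_abs_cos_add_abs_sin θ
    rw [hx0, hy0, abs_zero] at hsin
    rw [hy0, abs_zero] at this
    linarith
  have hxτ : |x| ≤ (B + 2) * |Real.cos τv| := by
    have : x = Real.sqrt (x ^ 2 + y ^ 2) * Real.cos τv := by
      rw [hcos, mul_div_cancel₀ _ hpos.ne']
    calc |x| = Real.sqrt (x ^ 2 + y ^ 2) * |Real.cos τv| := by
          conv_lhs => rw [this, abs_mul, abs_of_pos hpos]
      _ ≤ (B + 2) * |Real.cos τv| := by gcongr
  rw [div_le_iff₀ (by positivity)]
  linarith [one_le_abs_cos_add_abs_sin θ, abs_nonneg (Real.cos θ)]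
end
end

section
/- Fix δ₀ ∈ (0,1) and let δ₀ < |E| < 2 − δ₀. Then there are constants c > 0 and λ₀ > 0 (depending only on δ₀) such that for 0 < λ < λ₀ the following holds. Regard ε_1,…,ε_N as real variables in [−1,1] and set f(ε_1,…,ε_N) = τ_{M_N(E;ε)}(θ). Then ∂_j f ≥ 0 for every 1 ≤ j ≤ N, and for every 1 ≤ j < N and every θ, ∂_j f(θ) + ∂_{j+1} f(θ) ≥ c λ / ‖M_{N−j}(E; ε_{j+1},…,ε_N)‖², where M_{N−j}(E; ε_{j+1},…,ε_N) = g_E(ε_N)···g_E(ε_{j+1}). -/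
noncomputable section

/-- Operator norm of a `2 × 2` real matrix acting on Euclidean `ℝ²`. -/
def opNorm (g : Matrix (Fin 2) (Fin 2) ℝ) : ℝ :=
  ‖Matrix.toEuclideanCLM (𝕜 := ℝ) g‖

/-- Single-step Anderson–Bernoulli matrix `g_E(ε) = [[E - λε, -1],[1,0]]`. -/
def gE (lam E x : ℝ) : Matrix (Fin 2) (Fin 2) ℝ := !![E - lam * x, -1; 1, 0]

/-- Transfer matrix `M_N(E;ε) = g_E(ε_N) ⋯ g_E(ε_1)`. -/
def transfer (lam E : ℝ) (N : ℕ) (eps : Fin N → ℝ) : Matrix (Fin 2) (Fin 2) ℝ :=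
  ((List.ofFn fun j => gE lam E (eps j)).reverse).prod

/-- Partial transfer matrix `M_{N-j}(E; ε_{j+1},…,ε_N) = g_E(ε_N) ⋯ g_E(ε_{j+1})`
(the first `j` factors are dropped). -/
def transferFrom (lam E : ℝ) (N : ℕ) (eps : Fin N → ℝ) (j : ℕ) :
    Matrix (Fin 2) (Fin 2) ℝ :=
  (((List.ofFn fun i => gE lam E (eps i)).drop j).reverse).prod

/-- The unit complex number `e^{i τ_g(θ)}` defining the projective action of
`g` on the circle. -/
def projC (g : Matrix (Fin 2) (Fin 2) ℝ) (θ : ℝ) : ℂ :=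
  ((g 0 0 * Real.cos θ + g 0 1 * Real.sin θ : ℝ) +
      Complex.I * (g 1 0 * Real.cos θ + g 1 1 * Real.sin θ : ℝ)) /
    (Real.sqrt ((g 0 0 * Real.cos θ + g 0 1 * Real.sin θ) ^ 2 +
      (g 1 0 * Real.cos θ + g 1 1 * Real.sin θ) ^ 2) : ℝ)

open Filter Topology in
/-- A continuous argument of a nonvanishing differentiable curve `z` is differentiable, with
derivative `Im (z' / z)`. -/
theorem hasDerivAt_of_exp_I_mul_eq {F : ℝ → ℝ} {z : ℝ → ℂ} {z' : ℂ} {s₀ : ℝ}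
    (hF : ContinuousAt F s₀) (hz : HasDerivAt z z' s₀)
    (h : ∀ s, Complex.exp (Complex.I * F s) = z s / (‖z s‖ : ℝ)) :
    HasDerivAt F (z' / z s₀).im s₀ := by
  have hne : ∀ s, z s ≠ 0 := fun s h0 => by
    have := h s
    rw [h0, zero_div] at this
    exact Complex.exp_ne_zero _ this
  have hpolar : ∀ s, z s = (‖z s‖ : ℝ) * Complex.exp (Complex.I * F s) := fun s => by
    have : ((‖z s‖ : ℝ) : ℂ) ≠ 0 := by exact_mod_cast norm_ne_zero_iff.2 (hne s)
    rw [h s]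
    field_simp
  have hquot : ∀ s, z s / z s₀ =
      ((‖z s‖ / ‖z s₀‖ : ℝ) : ℂ) * Complex.exp (((F s - F s₀ : ℝ) : ℂ) * Complex.I) := fun s => by
    have e : (((F s - F s₀ : ℝ) : ℂ) * Complex.I) = Complex.I * F s - Complex.I * F s₀ := by
      push_cast
      ring
    rw [e, Complex.exp_sub, Complex.ofReal_div, div_mul_div_comm, ← hpolar s, ← hpolar s₀]
  have hlog : HasDerivAt (fun s => Complex.log (z s / z s₀)) (z' / z s₀) s₀ := by
    have := (hz.div_const (z s₀)).clog_real (by simp [div_self (hne s₀)])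
    simpa [div_self (hne s₀)] using this
  have him : HasDerivAt (fun s => F s₀ + (Complex.log (z s / z s₀)).im) (z' / z s₀).im s₀ :=
    (Complex.imCLM.hasFDerivAt.comp_hasDerivAt s₀ hlog).const_add (F s₀)
  refine him.congr_of_eventuallyEq ?_
  have hsmall : ∀ᶠ s in 𝓝 s₀, F s - F s₀ ∈ Set.Ioo (-Real.pi) Real.pi := by
    have hc : ContinuousAt (fun s => F s - F s₀) s₀ := hF.sub continuousAt_const
    refine hc.eventually_mem (Ioo_mem_nhds ?_ ?_) <;> simp [Real.pi_pos]
  filter_upwards [hsmall] with s hs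
  have hpos : 0 < ‖z s‖ / ‖z s₀‖ :=
    div_pos (norm_pos_iff.2 (hne s)) (norm_pos_iff.2 (hne s₀))
  rw [Complex.log_im, hquot s, Complex.arg_real_mul _ hpos, Complex.arg_exp_mul_I,
    (toIocMod_eq_self Real.two_pi_pos).2 ⟨hs.1, by linarith [hs.2]⟩]
  ring

/-- The vector `g (cos θ, sin θ)` read as a complex number. -/
def actC (g : Matrix (Fin 2) (Fin 2) ℝ) (θ : ℝ) : ℂ :=
  ⟨g 0 0 * Real.cos θ + g 0 1 * Real.sin θ, g 1 0 * Real.cos θ + g 1 1 * Real.sin θ⟩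

theorem projC_eq_actC_div_norm (g : Matrix (Fin 2) (Fin 2) ℝ) (θ : ℝ) :
    projC g θ = actC g θ / (‖actC g θ‖ : ℝ) := by
  have h : ‖actC g θ‖ = Real.sqrt ((g 0 0 * Real.cos θ + g 0 1 * Real.sin θ) ^ 2 +
      (g 1 0 * Real.cos θ + g 1 1 * Real.sin θ) ^ 2) := by
    rw [Complex.norm_def, Complex.normSq_apply, actC]
    ring_nf
  rw [h, projC]
  congr 1
  rw [actC, Complex.mk_eq_add_mul_I]
  ring

theorem normSq_actC_mul_le (L P : Matrix (Fin 2) (Fin 2) ℝ) (θ : ℝ) :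
    Complex.normSq (actC (L * P) θ) ≤ opNorm L ^ 2 * Complex.normSq (actC P θ) := by
  set v : Fin 2 → ℝ := ![(actC P θ).re, (actC P θ).im] with hv
  have h := (Matrix.toEuclideanCLM (𝕜 := ℝ) L).le_opNorm (WithLp.toLp 2 v)
  have h2 := pow_le_pow_left₀ (norm_nonneg _) h 2
  rw [mul_pow, EuclideanSpace.norm_sq_eq, EuclideanSpace.norm_sq_eq] at h2
  simp only [Matrix.toEuclideanCLM_toLp, Fin.sum_univ_two, Matrix.mulVec, dotProduct, hv,
    Real.norm_eq_abs, sq_abs, Matrix.cons_val_zero, Matrix.cons_val_one] at h2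
  rw [Complex.normSq_apply, Complex.normSq_apply, opNorm]
  simp only [actC, Matrix.mul_apply, Fin.sum_univ_two] at h2 ⊢
  linarith

theorem hasDerivAt_actC_mul_gE (L P : Matrix (Fin 2) (Fin 2) ℝ) (lam E θ s : ℝ) :
    HasDerivAt (fun s => actC (L * gE lam E s * P) θ)
      (-(lam * (actC P θ).re : ℝ) * ⟨L 0 0, L 1 0⟩) s := by
  have h : ∀ s, actC (L * gE lam E s * P) θ = actC (L * gE lam E 0 * P) θ +
      (s : ℂ) * (-(lam * (actC P θ).re : ℝ) * ⟨L 0 0, L 1 0⟩) := fun s => by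
    apply Complex.ext <;>
    simp [-Complex.ofReal_cos, -Complex.ofReal_sin, actC, gE, Matrix.mul_apply, Fin.sum_univ_two] <;> ring
  rw [funext h]
  simpa using ((Complex.ofRealCLM.hasDerivAt (x := s)).mul_const
    (-(lam * (actC P θ).re : ℝ) * (⟨L 0 0, L 1 0⟩ : ℂ))).const_add (actC (L * gE lam E 0 * P) θ)

theorem im_deriv_actC_div (L P : Matrix (Fin 2) (Fin 2) ℝ) (hL : L.det = 1) (lam E θ s : ℝ) :
    (-(lam * (actC P θ).re : ℝ) * ⟨L 0 0, L 1 0⟩ / actC (L * gE lam E s * P) θ : ℂ).im =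
      lam * (actC P θ).re ^ 2 / Complex.normSq (actC (L * gE lam E s * P) θ) := by
  rw [Complex.div_im, ← sub_div]
  congr 1
  rw [Matrix.det_fin_two] at hL
  rw [← mul_one (lam * (actC P θ).re ^ 2), ← hL]
  simp [-Complex.ofReal_cos, -Complex.ofReal_sin, actC, gE, Matrix.mul_apply, Fin.sum_univ_two]
  ring

/-- The product `g_E(ε_j) ⋯ g_E(ε_1)` of the first `j` factors of the transfer matrix. -/
def transferTo (lam E : ℝ) (N : ℕ) (eps : Fin N → ℝ) (j : ℕ) : Matrix (Fin 2) (Fin 2) ℝ :=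
  (((List.ofFn fun i => gE lam E (eps i)).take j).reverse).prod

theorem transferTo_succ (lam E : ℝ) (N : ℕ) (eps : Fin N → ℝ) (j : Fin N) :
    transferTo lam E N eps (j + 1) = gE lam E (eps j) * transferTo lam E N eps j := by
  have hj : (j : ℕ) < (List.ofFn fun i => gE lam E (eps i)).length := by simp
  rw [transferTo, transferTo, List.take_succ_eq_append_getElem hj]
  simp

theorem transfer_eq_transferFrom_mul (lam E : ℝ) (N : ℕ) (eps : Fin N → ℝ) (j : ℕ) :
    transfer lam E N eps = transferFrom lam E N eps j * transferTo lam E N eps j := by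
  rw [transferFrom, transferTo, ← List.prod_append, ← List.reverse_append,
    List.take_append_drop, transfer]

theorem transfer_update (lam E : ℝ) (N : ℕ) (eps : Fin N → ℝ) (j : Fin N) (s : ℝ) :
    transfer lam E N (Function.update eps j s) =
      transferFrom lam E N eps (j + 1) * gE lam E s * transferTo lam E N eps j := by
  have h : (List.ofFn fun i => gE lam E (Function.update eps j s i)) =
      (List.ofFn fun i => gE lam E (eps i)).set j (gE lam E s) := by
    apply List.ext_getElem
    · simp
    · intro i h1 h2
      rw [List.getElem_set]
      simp only [List.getElem_ofFn, Function.update_apply, Fin.ext_iff, eq_comm (a := i)]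
      split_ifs <;> rfl
  rw [transfer, h, List.set_eq_take_append_cons_drop, if_pos (by simp)]
  simp [transferFrom, transferTo, mul_assoc]

theorem det_transferFrom (lam E : ℝ) (N : ℕ) (eps : Fin N → ℝ) (j : ℕ) :
    (transferFrom lam E N eps j).det = 1 := by
  have key : ∀ l : List (Matrix (Fin 2) (Fin 2) ℝ), (∀ g ∈ l, g.det = 1) → l.prod.det = 1 := by
    intro l
    induction l with
    | nil => simp
    | cons a l ih => intro h; simp_all
  refine key _ fun g hg => ?_
  obtain ⟨i, rfl⟩ := (List.mem_ofFn' _ _).1 (List.mem_of_mem_drop (List.mem_reverse.1 hg))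
  simp [gE, Matrix.det_fin_two]

theorem hasDerivAt_lift_update {lam E θ : ℝ} {N : ℕ} {f : (Fin N → ℝ) → ℝ} (hf : Continuous f)
    (h : ∀ eps, Complex.exp (Complex.I * f eps) = projC (transfer lam E N eps) θ)
    (eps : Fin N → ℝ) (j : Fin N) :
    HasDerivAt (fun s => f (Function.update eps j s))
      (lam * (actC (transferTo lam E N eps j) θ).re ^ 2 /
        Complex.normSq (actC (transfer lam E N eps) θ)) (eps j) := by
  have hc : Continuous fun s => f (Function.update eps j s) :=
    hf.comp (continuous_const.update j continuous_id)
  have := hasDerivAt_of_exp_I_mul_eq hc.continuousAt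
    (hasDerivAt_actC_mul_gE (transferFrom lam E N eps (j + 1)) (transferTo lam E N eps j)
      lam E θ (eps j))
    (fun s => by rw [h, transfer_update, projC_eq_actC_div_norm])
  rwa [im_deriv_actC_div _ _ (det_transferFrom ..), ← transfer_update,
    Function.update_eq_self] at this


/-- Regarding `ε_1,…,ε_N ∈ [-1,1]` as real variables, the function
`f(ε) = τ_{M_N(E;ε)}(θ)` (any continuous lift of it) has all partial
derivatives `∂_j f ≥ 0`, and `∂_j f + ∂_{j+1} f ≥ c λ / ‖M_{N-j}(E;ε_{j+1},…,ε_N)‖²`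
for `1 ≤ j < N`, provided `δ₀ < |E| < 2 - δ₀` and `λ` is small. -/
theorem transfer_tau_partial_derivs
    (δ₀ : ℝ) (hδ₀ : 0 < δ₀) (hδ₀' : δ₀ < 1) :
    ∃ c lam0 : ℝ, 0 < c ∧ 0 < lam0 ∧
      ∀ lam : ℝ, 0 < lam → lam < lam0 →
        ∀ E : ℝ, δ₀ < |E| → |E| < 2 - δ₀ →
          ∀ (N : ℕ) (θ : ℝ) (f : (Fin N → ℝ) → ℝ),
            Continuous f →
            (∀ eps : Fin N → ℝ,
              Complex.exp (Complex.I * f eps) = projC (transfer lam E N eps) θ) →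
            ∀ eps : Fin N → ℝ, (∀ j, eps j ∈ Set.Icc (-1 : ℝ) 1) →
              (∀ j : Fin N,
                DifferentiableAt ℝ (fun s => f (Function.update eps j s)) (eps j) ∧
                0 ≤ deriv (fun s => f (Function.update eps j s)) (eps j)) ∧
              (∀ (j : Fin N) (hj : (j : ℕ) + 1 < N),
                c * lam / opNorm (transferFrom lam E N eps ((j : ℕ) + 1)) ^ 2 ≤
                  deriv (fun s => f (Function.update eps j s)) (eps j) +
                  deriv (fun s => f (Function.update eps ⟨(j : ℕ) + 1, hj⟩ s))
                    (eps ⟨(j : ℕ) + 1, hj⟩)) := by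
  refine ⟨1, 1, one_pos, one_pos, fun lam hlam _ E _ _ N θ f hf h eps _ => ⟨fun j => ?_, ?_⟩⟩
  · have hd := hasDerivAt_lift_update hf h eps j
    refine ⟨hd.differentiableAt, ?_⟩
    rw [hd.deriv]
    exact div_nonneg (mul_nonneg hlam.le (sq_nonneg _)) (Complex.normSq_nonneg _)
  · intro j hj
    rw [(hasDerivAt_lift_update hf h eps j).deriv,
      (hasDerivAt_lift_update hf h eps ⟨(j : ℕ) + 1, hj⟩).deriv, ← add_div, ← mul_add, one_mul]
    have hw : 0 < Complex.normSq (actC (transfer lam E N eps) θ) := by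
      refine Complex.normSq_pos.2 fun h0 => ?_
      have := h eps
      rw [projC_eq_actC_div_norm, h0, zero_div] at this
      exact Complex.exp_ne_zero _ this
    have hv : (actC (transferTo lam E N eps j) θ).re =
        (actC (transferTo lam E N eps (j + 1)) θ).im := by
      rw [transferTo_succ]
      simp [actC, gE, Matrix.mul_apply, Fin.sum_univ_two]
    have hle := normSq_actC_mul_le (transferFrom lam E N eps (j + 1))
      (transferTo lam E N eps (j + 1)) θ
    rw [← transfer_eq_transferFrom_mul] at hle
    have hn : (actC (transferTo lam E N eps j) θ).re ^ 2 +
        (actC (transferTo lam E N eps (j + 1)) θ).re ^ 2 =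
        Complex.normSq (actC (transferTo lam E N eps (j + 1)) θ) := by
      rw [hv, Complex.normSq_apply]
      ring
    have hop : 0 < opNorm (transferFrom lam E N eps (j + 1)) ^ 2 :=
      pos_of_mul_pos_left (hw.trans_le hle) (Complex.normSq_nonneg _)
    rw [hn, div_le_div_iff₀ hop hw, mul_assoc]
    exact mul_le_mul_of_nonneg_left (by linarith) hlam.le
end
end

section
/- Fix δ₀ ∈ (0,1) and let δ₀ < |E| < 2 − δ₀, and write E = 2 cos κ with 0 < κ < π. Then there are constants C > 0 and λ₀ > 0 (depending only on δ₀) such that for 0 < λ < λ₀ the Lyapunov exponent L(E) = lim_{N→∞} (1/N) 𝔼_ε[ log ‖M_N(E;ε)‖ ] exists and satisfies | L(E) − λ² / (8 sin² κ) | ≤ C λ³; equivalently, | L(E) − λ² / (2(4 − E²)) | ≤ C λ³. -/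
open Filter

noncomputable section

/-- `±1`-value of a Boolean (`true ↔ 1`, `false ↔ -1`). -/
def bval (b : Bool) : ℝ := if b then 1 else -1

/-- Transfer matrix with Bernoulli `±1` entries, cube encoded as `Fin N → Bool`. -/
def transferB (lam E : ℝ) (N : ℕ) (σ : Fin N → Bool) : Matrix (Fin 2) (Fin 2) ℝ :=
  transfer lam E N fun j => bval (σ j)

/-! ### Second order expansion of one step in a complex coordinate -/

/-- The squared unit phase `z / z̄ = e^{2iθ}` of `z = r e^{iθ}`. -/
def phase (z : ℂ) : ℂ := z / (starRingEnd ℂ) z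

lemma norm_phase {z : ℂ} (hz : z ≠ 0) : ‖phase z‖ = 1 := by
  rw [phase, norm_div, RCLike.norm_conj, div_self (norm_ne_zero_iff.mpr hz)]

lemma abs_log_one_sub_add_sub_le {x : ℝ} (hx : |x| ≤ 1 / 2) :
    |x + x ^ 2 / 2 + Real.log (1 - x)| ≤ 2 * |x| ^ 3 := by
  have h := Real.abs_log_sub_add_sum_range_le (x := x) (by linarith) 2
  norm_num [Finset.sum_range_succ] at h
  refine h.trans ?_
  rw [div_le_iff₀ (by linarith)]
  nlinarith [pow_nonneg (abs_nonneg x) 3]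

lemma abs_mean_log_sub_le {h S P : ℝ} (hh : 0 < h) (hh' : h ≤ 1 / 4) (hS : 0 ≤ S) (hS' : S ≤ 1)
    (hP : |P| ≤ 1 / 2) :
    |(Real.log (1 - (2 * h * P - h ^ 2 * S)) + Real.log (1 - (2 * -h * P - (-h) ^ 2 * S))) / 2
      - h ^ 2 * (S - 2 * P ^ 2)| ≤ 17 * h ^ 3 := by
  obtain ⟨hP1, hP2⟩ := abs_le.mp hP
  have hhP1 : h * P ≤ h / 2 := by nlinarith
  have hhP2 : -(h / 2) ≤ h * P := by nlinarith
  have hhS : h ^ 2 * S ≤ h := by nlinarith [mul_le_mul_of_nonneg_left hS' (sq_nonneg h)]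
  have hhS0 : 0 ≤ h ^ 2 * S := by positivity
  have b1 : |2 * h * P - h ^ 2 * S| ≤ 2 * h := abs_le.mpr ⟨by linarith, by linarith⟩
  have b2 : |2 * -h * P - (-h) ^ 2 * S| ≤ 2 * h := abs_le.mpr ⟨by linarith, by linarith⟩
  have e1 := abs_log_one_sub_add_sub_le (b1.trans (by linarith))
  have e2 := abs_log_one_sub_add_sub_le (b2.trans (by linarith))
  have c1 := pow_le_pow_left₀ (abs_nonneg _) b1 3
  have c2 := pow_le_pow_left₀ (abs_nonneg _) b2 3
  have d1 := abs_le.mp (e1.trans (by linarith : _ ≤ 2 * (2 * h) ^ 3))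
  have d2 := abs_le.mp (e2.trans (by linarith : _ ≤ 2 * (2 * h) ^ 3))
  have hS4 : h ^ 4 * S ^ 2 ≤ h ^ 3 := by
    have : S ^ 2 ≤ 1 := by nlinarith
    nlinarith [mul_le_mul_of_nonneg_left this (by positivity : 0 ≤ h ^ 4),
      pow_pos hh 3, mul_le_mul_of_nonneg_left hh' (pow_pos hh 3).le]
  have hS40 : 0 ≤ h ^ 4 * S ^ 2 := by positivity
  rw [abs_le]
  constructor <;> nlinarith [d1.1, d1.2, d2.1, d2.2, pow_pos hh 3]

/-- Multiplication by `e` after a shift of the real part by `t` times the imaginary part. -/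
def kick (e : ℂ) (t : ℝ) (z : ℂ) : ℂ := e * (z - (t * z.im : ℝ))

lemma normSq_kick {e : ℂ} (he : ‖e‖ = 1) (t : ℝ) {z : ℂ} (hz : z ≠ 0) :
    Complex.normSq (kick e t z) = Complex.normSq z *
      (1 - (2 * t * (z.re * z.im / Complex.normSq z) - t ^ 2 * (z.im ^ 2 / Complex.normSq z))) := by
  have hn : Complex.normSq z ≠ 0 := (Complex.normSq_pos.mpr hz).ne'
  have he' : Complex.normSq e = 1 := by rw [Complex.normSq_eq_norm_sq, he, one_pow]
  rw [kick, Complex.normSq_mul, he']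
  field_simp
  simp only [Complex.normSq_apply, Complex.sub_re, Complex.sub_im, Complex.ofReal_re,
    Complex.ofReal_im]
  ring

lemma kick_ne_zero {e : ℂ} (he : ‖e‖ = 1) {t : ℝ} {z : ℂ} (hz : z ≠ 0) : kick e t z ≠ 0 := by
  refine mul_ne_zero (norm_ne_zero_iff.mp (by rw [he]; exact one_ne_zero)) fun h => hz ?_
  have him : z.im = 0 := by simpa using congrArg Complex.im h
  rw [him] at h
  simpa using h

lemma norm_phase_kick_sub_le {e : ℂ} (he : ‖e‖ = 1) {t : ℝ} (ht : |t| ≤ 1 / 2) {z : ℂ}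
    (hz : z ≠ 0) : ‖phase (kick e t z) - e ^ 2 * phase z‖ ≤ 4 * |t| := by
  have he0 : e ≠ 0 := norm_ne_zero_iff.mp (by rw [he]; exact one_ne_zero)
  have hec : (starRingEnd ℂ) e = e⁻¹ := by
    rw [Complex.inv_def, Complex.normSq_eq_norm_sq, he]; simp
  set a : ℂ := ((t * z.im : ℝ) : ℂ) with ha
  have hzn : 0 < ‖z‖ := norm_pos_iff.mpr hz
  have han : ‖a‖ ≤ |t| * ‖z‖ := by
    rw [ha, Complex.norm_real, Real.norm_eq_abs, abs_mul]
    gcongr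
    exact Complex.abs_im_le_norm z
  have hzc : (starRingEnd ℂ) z ≠ 0 := (map_ne_zero _).mpr hz
  have hd : ‖z‖ / 2 ≤ ‖(starRingEnd ℂ) z - a‖ := by
    have h1 := norm_sub_norm_le ((starRingEnd ℂ) z) a
    rw [RCLike.norm_conj] at h1
    nlinarith
  have hd0 : (starRingEnd ℂ) z - a ≠ 0 := norm_pos_iff.mp (by linarith)
  have key : phase (kick e t z) - e ^ 2 * phase z =
      e ^ 2 * (a * (z - (starRingEnd ℂ) z) / ((starRingEnd ℂ) z * ((starRingEnd ℂ) z - a))) := by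
    have hca : (starRingEnd ℂ) a = a := Complex.conj_ofReal _
    rw [phase, phase, kick, ← ha, map_mul, map_sub, hca, hec]
    field_simp
    ring
  rw [key, norm_mul, norm_pow, he, one_pow, one_mul, norm_div, norm_mul, norm_mul,
    RCLike.norm_conj, div_le_iff₀ (by positivity)]
  have h2 : ‖z - (starRingEnd ℂ) z‖ ≤ 2 * ‖z‖ := by
    refine (norm_sub_le _ _).trans ?_
    rw [RCLike.norm_conj]; linarith
  calc ‖a‖ * ‖z - (starRingEnd ℂ) z‖ ≤ (|t| * ‖z‖) * (2 * ‖z‖) := by gcongr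
    _ = 4 * |t| * (‖z‖ * (‖z‖ / 2)) := by ring
    _ ≤ _ := by gcongr

/-- `log |z|²` plus the second order corrector with coefficients `c₁, c₂`. -/
def corrLog (h : ℝ) (c₁ c₂ z : ℂ) : ℝ :=
  Real.log (Complex.normSq z) + h ^ 2 * (c₁ * phase z + c₂ * phase z ^ 2).re

lemma re_phase_combination {z : ℂ} (hz : z ≠ 0) :
    (phase z / 2 - phase z ^ 2 / 4).re = 1 / 4 - (z.im ^ 2 / Complex.normSq z
      - 2 * (z.re * z.im / Complex.normSq z) ^ 2) := by
  have hn : Complex.normSq z ≠ 0 := (Complex.normSq_pos.mpr hz).ne'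
  have hp : phase z = ⟨(z.re ^ 2 - z.im ^ 2) / Complex.normSq z,
      2 * (z.re * z.im / Complex.normSq z)⟩ := by
    rw [phase, div_eq_mul_inv, Complex.inv_def, Complex.normSq_conj, Complex.conj_conj]
    apply Complex.ext <;> simp <;> ring
  have h1 : (phase z / 2 - phase z ^ 2 / 4).re =
      (phase z).re / 2 - ((phase z).re ^ 2 - (phase z).im ^ 2) / 4 := by
    rw [Complex.sub_re, Complex.div_ofNat_re, Complex.div_ofNat_re, sq, Complex.mul_re]
    ring
  rw [h1, hp]
  field_simp
  rw [Complex.normSq_apply]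
  ring

lemma abs_mean_corrLog_sub_le {h B : ℝ} {e c₁ c₂ : ℂ} (hh : 0 < h) (hh' : h ≤ 1 / 4)
    (he : ‖e‖ = 1) (h₁ : c₁ * (e ^ 2 - 1) = 1 / 2) (h₂ : c₂ * (e ^ 4 - 1) = -1 / 4)
    (hB₁ : ‖c₁‖ ≤ B) (hB₂ : ‖c₂‖ ≤ B) {z : ℂ} (hz : z ≠ 0) :
    |(corrLog h c₁ c₂ (kick e h z) + corrLog h c₁ c₂ (kick e (-h) z)) / 2
      - corrLog h c₁ c₂ z - h ^ 2 / 4| ≤ (17 + 12 * B) * h ^ 3 := by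
  have hnpos : 0 < Complex.normSq z := Complex.normSq_pos.mpr hz
  have hna : Complex.normSq z = z.re ^ 2 + z.im ^ 2 := by rw [Complex.normSq_apply]; ring
  set S : ℝ := z.im ^ 2 / Complex.normSq z with hS
  set P : ℝ := z.re * z.im / Complex.normSq z with hP
  have hS0 : 0 ≤ S := by positivity
  have hS1 : S ≤ 1 := by rw [hS, div_le_one hnpos, hna]; nlinarith [sq_nonneg z.re]
  have hP1 : |P| ≤ 1 / 2 := by
    rw [hP, abs_div, abs_of_pos hnpos, div_le_iff₀ hnpos, hna, abs_mul]
    nlinarith [sq_nonneg (|z.re| - |z.im|), sq_abs z.re, sq_abs z.im]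
  have hlog := abs_mean_log_sub_le hh hh' hS0 hS1 hP1
  have osc : ∀ t : ℝ, |t| = h →
      |(c₁ * (phase (kick e t z) - e ^ 2 * phase z)
        + c₂ * (phase (kick e t z) ^ 2 - (e ^ 2 * phase z) ^ 2)).re| ≤ 12 * B * h := by
    intro t ht
    have hd := norm_phase_kick_sub_le he (t := t) (by linarith) hz
    rw [ht] at hd
    have hs : ‖phase (kick e t z) + e ^ 2 * phase z‖ ≤ 2 := by
      refine (norm_add_le _ _).trans ?_
      rw [norm_phase (kick_ne_zero he hz), norm_mul, norm_phase hz, norm_pow, he]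
      norm_num
    have hB : 0 ≤ B := (norm_nonneg _).trans hB₁
    refine (Complex.abs_re_le_norm _).trans ((norm_add_le _ _).trans ?_)
    rw [sq_sub_sq, norm_mul, norm_mul, norm_mul]
    calc _ ≤ B * (4 * h) + B * (2 * (4 * h)) := by gcongr
      _ = 12 * B * h := by ring
  have split : ∀ t : ℝ, corrLog h c₁ c₂ (kick e t z) = corrLog h c₁ c₂ z +
      Real.log (1 - (2 * t * P - t ^ 2 * S)) +
      h ^ 2 * (c₁ * (phase (kick e t z) - e ^ 2 * phase z)
        + c₂ * (phase (kick e t z) ^ 2 - (e ^ 2 * phase z) ^ 2)).re +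
      h ^ 2 * (1 / 4 - (S - 2 * P ^ 2)) := by
    intro t
    have hk := normSq_kick he t hz
    have hk0 : Complex.normSq (kick e t z) ≠ 0 :=
      (Complex.normSq_pos.mpr (kick_ne_zero he hz)).ne'
    rw [hk] at hk0
    rw [hS, hP, ← re_phase_combination hz, corrLog, corrLog, hk,
      Real.log_mul hnpos.ne' (right_ne_zero_of_mul hk0)]
    have hre : (c₁ * phase (kick e t z) + c₂ * phase (kick e t z) ^ 2).re =
        (c₁ * phase z + c₂ * phase z ^ 2).re
        + (c₁ * (phase (kick e t z) - e ^ 2 * phase z)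
          + c₂ * (phase (kick e t z) ^ 2 - (e ^ 2 * phase z) ^ 2)).re
        + (phase z / 2 - phase z ^ 2 / 4).re := by
      rw [← Complex.add_re, ← Complex.add_re]
      congr 1
      linear_combination phase z * h₁ + phase z ^ 2 * h₂
    rw [hre]
    ring
  have o1 := abs_le.mp (osc h (abs_of_pos hh))
  have o2 := abs_le.mp (osc (-h) (by rw [abs_neg, abs_of_pos hh]))
  obtain ⟨l1, l2⟩ := abs_le.mp hlog
  rw [split h, split (-h), abs_le]
  have hh2 : 0 < h ^ 2 := by positivity
  constructor <;>
    nlinarith [mul_le_mul_of_nonneg_left o1.1 hh2.le, mul_le_mul_of_nonneg_left o1.2 hh2.le,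
      mul_le_mul_of_nonneg_left o2.1 hh2.le, mul_le_mul_of_nonneg_left o2.2 hh2.le]

/-! ### Averages over the cube and the cocycle structure -/

/-- Expectation over `N` independent fair signs. -/
def cubeMean (N : ℕ) (f : (Fin N → Bool) → ℝ) : ℝ := (∑ σ, f σ) / 2 ^ N

lemma cubeMean_const (N : ℕ) (a : ℝ) : cubeMean N (fun _ => a) = a := by
  simp [cubeMean]

lemma cubeMean_add (N : ℕ) (f g : (Fin N → Bool) → ℝ) :
    cubeMean N (fun σ => f σ + g σ) = cubeMean N f + cubeMean N g := by
  simp [cubeMean, Finset.sum_add_distrib, add_div]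

lemma cubeMean_sub (N : ℕ) (f g : (Fin N → Bool) → ℝ) :
    cubeMean N (fun σ => f σ - g σ) = cubeMean N f - cubeMean N g := by
  simp [cubeMean, Finset.sum_sub_distrib, sub_div]

lemma cubeMean_const_mul (N : ℕ) (a : ℝ) (f : (Fin N → Bool) → ℝ) :
    cubeMean N (fun σ => a * f σ) = a * cubeMean N f := by
  simp [cubeMean, ← Finset.mul_sum, mul_div_assoc]

lemma cubeMean_sum {ι : Type*} (s : Finset ι) (N : ℕ) (f : ι → (Fin N → Bool) → ℝ) :
    cubeMean N (fun σ => ∑ j ∈ s, f j σ) = ∑ j ∈ s, cubeMean N (f j) := by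
  simp only [cubeMean]
  rw [Finset.sum_comm, Finset.sum_div]

lemma cubeMean_mono {N : ℕ} {f g : (Fin N → Bool) → ℝ} (h : ∀ σ, f σ ≤ g σ) :
    cubeMean N f ≤ cubeMean N g := by
  unfold cubeMean
  gcongr
  exact h _

lemma abs_cubeMean_le {N : ℕ} {f : (Fin N → Bool) → ℝ} {r : ℝ} (h : ∀ σ, |f σ| ≤ r) :
    |cubeMean N f| ≤ r := by
  have h₁ := cubeMean_mono fun σ => (abs_le.mp (h σ)).1
  have h₂ := cubeMean_mono fun σ => (abs_le.mp (h σ)).2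
  rw [cubeMean_const] at h₁ h₂
  exact abs_le.mpr ⟨h₁, h₂⟩

lemma cubeMean_succ (N : ℕ) (f : (Fin (N + 1) → Bool) → ℝ) :
    cubeMean (N + 1) f = cubeMean N fun σ =>
      (f (Fin.snoc (α := fun _ => Bool) σ true) + f (Fin.snoc (α := fun _ => Bool) σ false)) / 2 := by
  simp only [cubeMean]
  rw [← (Fin.snocEquiv fun _ => Bool).sum_comp f, Fintype.sum_prod_type, Fintype.sum_bool,
    ← Finset.sum_add_distrib, ← Finset.sum_div, pow_succ, div_div, mul_comm (2 : ℝ)]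
  rfl

lemma cubeMean_append (m n : ℕ) (f : (Fin (m + n) → Bool) → ℝ) :
    cubeMean (m + n) f = cubeMean m fun σ => cubeMean n fun τ => f (Fin.append σ τ) := by
  simp only [cubeMean]
  rw [← (Fin.appendEquiv m n).sum_comp f, Fintype.sum_prod_type, ← Finset.sum_div, pow_add,
    div_div, mul_comm ((2 : ℝ) ^ m)]
  rfl

lemma transferB_snoc (lam E : ℝ) (N : ℕ) (σ : Fin N → Bool) (b : Bool) :
    transferB lam E (N + 1) (Fin.snoc (α := fun _ => Bool) σ b) =
      gE lam E (bval b) * transferB lam E N σ := by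
  simp [transferB, transfer, -List.ofFn_succ, List.ofFn_succ_last]

lemma transferB_append (lam E : ℝ) (m n : ℕ) (σ : Fin m → Bool) (τ : Fin n → Bool) :
    transferB lam E (m + n) (Fin.append σ τ) = transferB lam E n τ * transferB lam E m σ := by
  have h : (fun j => gE lam E (bval (Fin.append σ τ j))) =
      Fin.append (fun j => gE lam E (bval (σ j))) (fun j => gE lam E (bval (τ j))) := by
    ext1 j
    refine Fin.addCases (fun i => ?_) (fun i => ?_) j <;> simp
  simp only [transferB, transfer]
  rw [h, List.ofFn_fin_append, List.reverse_append, List.prod_append]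

lemma det_transferB (lam E : ℝ) (N : ℕ) (σ : Fin N → Bool) : (transferB lam E N σ).det = 1 := by
  induction N with
  | zero => simp [transferB, transfer]
  | succ N ih =>
    rw [← Fin.snoc_init_self σ, transferB_snoc, Matrix.det_mul, ih]
    simp [gE, Matrix.det_fin_two]

open Matrix in
lemma mulVec_ne_zero_of_det_eq_one {M : Matrix (Fin 2) (Fin 2) ℝ} (hM : M.det = 1)
    {v : Fin 2 → ℝ} (hv : v ≠ 0) : M *ᵥ v ≠ 0 := fun h =>
  hv (Matrix.eq_zero_of_mulVec_eq_zero (by rw [hM]; exact one_ne_zero) h)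

open Matrix in
lemma abs_cubeMean_transferB_sub_le {lam E m r : ℝ} {Φ : (Fin 2 → ℝ) → ℝ}
    (hΦ : ∀ v, v ≠ 0 →
      |(Φ (gE lam E 1 *ᵥ v) + Φ (gE lam E (-1) *ᵥ v)) / 2 - Φ v - m| ≤ r)
    {v : Fin 2 → ℝ} (hv : v ≠ 0) (N : ℕ) :
    |cubeMean N (fun σ => Φ (transferB lam E N σ *ᵥ v)) - Φ v - N * m| ≤ N * r := by
  induction N with
  | zero => simp [cubeMean, transferB, transfer]
  | succ N ih =>
    have step := abs_cubeMean_le fun σ : Fin N → Bool =>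
      hΦ _ (mulVec_ne_zero_of_det_eq_one (det_transferB lam E N σ) hv)
    rw [cubeMean_sub, cubeMean_sub, cubeMean_const] at step
    rw [cubeMean_succ]
    simp only [transferB_snoc, bval, if_true, Bool.false_eq_true, if_false, ← mulVec_mulVec]
    obtain ⟨s1, s2⟩ := abs_le.mp step
    obtain ⟨i1, i2⟩ := abs_le.mp ih
    push_cast
    rw [abs_le]
    constructor <;> linarith

/-! ### Operator norm estimates -/

open Matrix

lemma norm_toLp_fin_two (v : Fin 2 → ℝ) : ‖WithLp.toLp 2 v‖ = √(v 0 ^ 2 + v 1 ^ 2) := by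
  simp [EuclideanSpace.norm_eq, Fin.sum_univ_two]

lemma norm_toLp_mulVec_le (M : Matrix (Fin 2) (Fin 2) ℝ) (v : Fin 2 → ℝ) :
    ‖WithLp.toLp 2 (M *ᵥ v)‖ ≤ opNorm M * ‖WithLp.toLp 2 v‖ := by
  rw [← toEuclideanCLM_toLp (𝕜 := ℝ)]
  exact ContinuousLinearMap.le_opNorm _ _

lemma abs_cross_le (v w : Fin 2 → ℝ) :
    |v 0 * w 1 - v 1 * w 0| ≤ ‖WithLp.toLp 2 v‖ * ‖WithLp.toLp 2 w‖ := by
  rw [norm_toLp_fin_two, norm_toLp_fin_two, ← Real.sqrt_mul (by positivity)]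
  refine Real.abs_le_sqrt ?_
  nlinarith [sq_nonneg (v 0 * w 0 + v 1 * w 1)]

lemma abs_cross_le_of_det_eq_one {M : Matrix (Fin 2) (Fin 2) ℝ} (hM : M.det = 1)
    (v w : Fin 2 → ℝ) :
    |v 0 * w 1 - v 1 * w 0| ≤ ‖WithLp.toLp 2 (M *ᵥ v)‖ * ‖WithLp.toLp 2 (M *ᵥ w)‖ := by
  refine le_of_eq_of_le (congrArg _ ?_) (abs_cross_le (M *ᵥ v) (M *ᵥ w))
  rw [det_fin_two] at hM
  simp only [mulVec, dotProduct, Fin.sum_univ_two]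
  linear_combination (-(v 0 * w 1 - v 1 * w 0)) * hM

lemma opNorm_le_add (M : Matrix (Fin 2) (Fin 2) ℝ) :
    opNorm M ≤ ‖WithLp.toLp 2 (M *ᵥ ![1, 0])‖ + ‖WithLp.toLp 2 (M *ᵥ ![0, 1])‖ := by
  refine ContinuousLinearMap.opNorm_le_bound _ (by positivity) fun x => ?_
  have hx : toEuclideanCLM (𝕜 := ℝ) M x =
      x 0 • WithLp.toLp 2 (M *ᵥ ![1, 0]) + x 1 • WithLp.toLp 2 (M *ᵥ ![0, 1]) := by
    ext i
    fin_cases i <;> simp [mulVec, dotProduct, Fin.sum_univ_two] <;> ring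
  have h0 : ‖x 0‖ ≤ ‖x‖ := PiLp.norm_apply_le x 0
  have h1 : ‖x 1‖ ≤ ‖x‖ := PiLp.norm_apply_le x 1
  rw [hx]
  refine (norm_add_le _ _).trans ?_
  rw [norm_smul, norm_smul, add_mul, mul_comm _ ‖x‖, mul_comm _ ‖x‖]
  gcongr

lemma one_le_opNorm {M : Matrix (Fin 2) (Fin 2) ℝ} (hM : M.det = 1) : 1 ≤ opNorm M := by
  have h := abs_cross_le_of_det_eq_one hM ![1, 0] ![0, 1]
  have h0 := norm_toLp_mulVec_le M ![1, 0]
  have h1 := norm_toLp_mulVec_le M ![0, 1]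
  simp only [norm_toLp_fin_two ![1, 0], norm_toLp_fin_two ![0, 1]] at h0 h1
  norm_num at h h0 h1
  have hn : 0 ≤ opNorm M := norm_nonneg _
  nlinarith [mul_le_mul h0 h1 (norm_nonneg _) hn]

lemma log_opNorm_mul_le {A B : Matrix (Fin 2) (Fin 2) ℝ} (hA : A.det = 1) (hB : B.det = 1) :
    Real.log (opNorm (A * B)) ≤ Real.log (opNorm A) + Real.log (opNorm B) := by
  have hA1 := one_le_opNorm hA
  have hB1 := one_le_opNorm hB
  have hAB := one_le_opNorm (M := A * B) (by rw [det_mul, hA, hB, one_mul])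
  rw [← Real.log_mul (by positivity) (by positivity)]
  refine Real.log_le_log (by positivity) ?_
  unfold opNorm
  rw [map_mul]
  exact norm_mul_le _ _

/-- Of the images of the vectors `(1, j)`, `j < k`, at most one is much shorter than `‖M‖`. -/
lemma log_opNorm_le_sum {M : Matrix (Fin 2) (Fin 2) ℝ} (hM : M.det = 1) {k : ℕ} (hk : 0 < k) :
    ((k : ℝ) - 2) * Real.log (opNorm M) - ((k : ℝ) - 1) * Real.log (3 + 2 * k) ≤
      ∑ j ∈ Finset.range k, Real.log ‖WithLp.toLp 2 (M *ᵥ ![1, (j : ℝ)])‖ := by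
  have hN := one_le_opNorm hM
  set v : ℕ → EuclideanSpace ℝ (Fin 2) := fun j => WithLp.toLp 2 (M *ᵥ ![1, (j : ℝ)]) with hv
  have hkpos : (0 : ℝ) < 3 + 2 * k := by positivity
  have hpair : ∀ i < k, ∀ j < k, i < j →
      opNorm M / (3 + 2 * k) ≤ ‖v i‖ ∨ opNorm M / (3 + 2 * k) ≤ ‖v j‖ := by
    intro i hi j hj hij
    by_contra! hcon
    obtain ⟨h1, h2⟩ := hcon
    set r := opNorm M / (3 + 2 * k) with hr
    have hijR : (1 : ℝ) ≤ j - i := by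
      have : (i : ℝ) + 1 ≤ j := by exact_mod_cast hij
      linarith
    have hikR : (i : ℝ) ≤ k := by exact_mod_cast hi.le
    have e2 : ((j : ℝ) - i) • WithLp.toLp 2 (M *ᵥ ![0, 1]) = v j - v i := by
      ext l
      fin_cases l <;> simp [hv] <;> ring
    have e1 : WithLp.toLp 2 (M *ᵥ ![1, 0]) = v i - (i : ℝ) • WithLp.toLp 2 (M *ᵥ ![0, 1]) := by
      ext l
      fin_cases l <;> simp [hv] <;> ring
    have n2 : ‖WithLp.toLp 2 (M *ᵥ ![0, 1])‖ ≤ 2 * r := by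
      have h3 : ((j : ℝ) - i) * ‖WithLp.toLp 2 (M *ᵥ ![0, 1])‖ ≤ ‖v j‖ + ‖v i‖ := by
        rw [← abs_of_nonneg (by linarith : (0 : ℝ) ≤ j - i), ← Real.norm_eq_abs, ← norm_smul, e2]
        exact norm_sub_le _ _
      nlinarith [norm_nonneg (WithLp.toLp 2 (M *ᵥ ![0, 1]))]
    have n1 : ‖WithLp.toLp 2 (M *ᵥ ![1, 0])‖ ≤ ‖v i‖ + k * (2 * r) := by
      rw [e1]
      refine (norm_sub_le _ _).trans ?_
      rw [norm_smul, Real.norm_of_nonneg (by positivity)]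
      gcongr
    have hMr : opNorm M = r * (3 + 2 * k) := by rw [hr]; field_simp
    have := opNorm_le_add M
    nlinarith
  obtain ⟨i, hi, hmain⟩ : ∃ i < k, ∀ j < k, j ≠ i → opNorm M / (3 + 2 * k) ≤ ‖v j‖ := by
    by_cases hall : ∀ j < k, opNorm M / (3 + 2 * k) ≤ ‖v j‖
    · exact ⟨0, hk, fun j hj _ => hall j hj⟩
    · push Not at hall
      obtain ⟨i, hi, hlt⟩ := hall
      refine ⟨i, hi, fun j hj hne => ?_⟩
      rcases lt_or_gt_of_ne hne with h | h
      · exact (hpair j hj i hi h).resolve_right hlt.not_ge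
      · exact (hpair i hi j hj h).resolve_left hlt.not_ge
  have hlow : -Real.log (opNorm M) ≤ Real.log ‖v i‖ := by
    have h : 1 ≤ ‖v i‖ * ‖WithLp.toLp 2 (M *ᵥ ![0, 1])‖ :=
      le_of_eq_of_le (by simp) (abs_cross_le_of_det_eq_one hM ![1, (i : ℝ)] ![0, 1])
    have h1 : ‖WithLp.toLp 2 (M *ᵥ ![0, 1])‖ ≤ opNorm M :=
      (norm_toLp_mulVec_le M ![0, 1]).trans_eq (by rw [norm_toLp_fin_two ![0, 1]]; simp)
    rw [← Real.log_inv]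
    refine Real.log_le_log (by positivity) ?_
    rw [inv_le_iff_one_le_mul₀ (by positivity)]
    exact h.trans (by gcongr)
  rw [← Finset.add_sum_erase _ _ (Finset.mem_range.mpr hi)]
  have hsum := Finset.card_nsmul_le_sum ((Finset.range k).erase i) (fun j => Real.log ‖v j‖)
    (Real.log (opNorm M) - Real.log (3 + 2 * k)) fun j hj => by
      obtain ⟨hne, hjk⟩ := Finset.mem_erase.mp hj
      rw [← Real.log_div (by positivity) (by positivity)]
      exact Real.log_le_log (by positivity) (hmain j (Finset.mem_range.mp hjk) hne)
  rw [Finset.card_erase_of_mem (Finset.mem_range.mpr hi), Finset.card_range, nsmul_eq_mul,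
    Nat.cast_sub hk, Nat.cast_one] at hsum
  linarith

/-! ### Growth of a single vector -/

/-- Complex coordinate in which the unperturbed transfer matrix with `E = 2c`, `c² + s² = 1`
is multiplication by `c + i s`. -/
def prufer (c s : ℝ) (v : Fin 2 → ℝ) : ℂ := ⟨c * v 0 - v 1, s * v 0⟩

lemma prufer_gE_mulVec {c s : ℝ} (hcs : c ^ 2 + s ^ 2 = 1) (hs : s ≠ 0) (lam x : ℝ)
    (v : Fin 2 → ℝ) :
    prufer c s (gE lam (2 * c) x *ᵥ v) = kick ⟨c, s⟩ (lam / s * x) (prufer c s v) := by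
  have h : lam / s * x * (s * v 0) = lam * x * v 0 := by field_simp
  apply Complex.ext
  · simp [prufer, kick, gE, mulVec, dotProduct, Fin.sum_univ_two, h, -mul_eq_mul_right_iff,
      -mul_eq_mul_left_iff]
    linear_combination v 0 * hcs
  · simp [prufer, kick, gE, mulVec, dotProduct, Fin.sum_univ_two, h]
    ring

lemma prufer_ne_zero {c s : ℝ} (hs : s ≠ 0) {v : Fin 2 → ℝ} (hv : v ≠ 0) :
    prufer c s v ≠ 0 := by
  intro h
  have h0 : v 0 = 0 := by simpa [prufer, hs] using congrArg Complex.im h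
  have h1 : v 1 = 0 := by simpa [prufer, h0] using congrArg Complex.re h
  exact hv (by ext i; fin_cases i <;> assumption)

lemma abs_corrLog_prufer_sub_le {c s : ℝ} (hcs : c ^ 2 + s ^ 2 = 1) (hs : s ≠ 0) (h : ℝ)
    (c₁ c₂ : ℂ) : ∃ K, ∀ v : Fin 2 → ℝ, v ≠ 0 →
      |corrLog h c₁ c₂ (prufer c s v) - 2 * Real.log ‖WithLp.toLp 2 v‖| ≤ K := by
  have hc1 : 0 < 1 - |c| := by
    have : |c| < 1 := by
      rw [← sq_lt_one_iff_abs_lt_one]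
      nlinarith [sq_pos_of_ne_zero hs]
    linarith
  refine ⟨|Real.log (1 - |c|)| + Real.log 2 + h ^ 2 * (‖c₁‖ + ‖c₂‖), fun v hv => ?_⟩
  have hz := prufer_ne_zero (c := c) hs hv
  have hzpos := Complex.normSq_pos.mpr hz
  have hn : 0 < ‖WithLp.toLp 2 v‖ := norm_pos_iff.mpr (by simpa using hv)
  have hsq : ‖WithLp.toLp 2 v‖ ^ 2 = v 0 ^ 2 + v 1 ^ 2 := by
    rw [norm_toLp_fin_two, Real.sq_sqrt (by positivity)]
  have hq : Complex.normSq (prufer c s v) = v 0 ^ 2 + v 1 ^ 2 - 2 * c * (v 0 * v 1) := by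
    simp only [prufer, Complex.normSq_mk]
    linear_combination v 0 ^ 2 * hcs
  have hcv : |2 * c * (v 0 * v 1)| ≤ |c| * (v 0 ^ 2 + v 1 ^ 2) := by
    rw [abs_mul, abs_mul, abs_two, abs_mul]
    nlinarith [mul_nonneg (abs_nonneg c) (sq_nonneg (|v 0| - |v 1|)), sq_abs (v 0), sq_abs (v 1)]
  obtain ⟨b1, b2⟩ := abs_le.mp hcv
  have hlog : 2 * Real.log ‖WithLp.toLp 2 v‖ = Real.log (‖WithLp.toLp 2 v‖ ^ 2) := by
    rw [Real.log_pow]; norm_num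
  have l1 : Real.log (1 - |c|) + 2 * Real.log ‖WithLp.toLp 2 v‖ ≤
      Real.log (Complex.normSq (prufer c s v)) := by
    rw [hlog, ← Real.log_mul hc1.ne' (by positivity)]
    refine Real.log_le_log (by positivity) ?_
    rw [hsq, hq]; linarith
  have l2 : Real.log (Complex.normSq (prufer c s v)) ≤
      Real.log 2 + 2 * Real.log ‖WithLp.toLp 2 v‖ := by
    rw [hlog, ← Real.log_mul two_ne_zero (by positivity)]
    refine Real.log_le_log hzpos ?_
    rw [hsq, hq]; nlinarith [sq_nonneg (v 0), sq_nonneg (v 1)]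
  have l3 : |(c₁ * phase (prufer c s v) + c₂ * phase (prufer c s v) ^ 2).re| ≤ ‖c₁‖ + ‖c₂‖ := by
    refine (Complex.abs_re_le_norm _).trans ((norm_add_le _ _).trans ?_)
    rw [norm_mul, norm_mul, norm_pow, norm_phase hz]
    norm_num
  obtain ⟨m1, m2⟩ := abs_le.mp l3
  have hlog2 : 0 ≤ Real.log 2 := Real.log_nonneg (by norm_num)
  rw [corrLog, abs_le]
  constructor <;>
    nlinarith [mul_le_mul_of_nonneg_left m1 (sq_nonneg h),
      mul_le_mul_of_nonneg_left m2 (sq_nonneg h), neg_abs_le (Real.log (1 - |c|)),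
      abs_nonneg (Real.log (1 - |c|))]

lemma abs_cubeMean_log_norm_sub_le {c s lam B : ℝ} (hcs : c ^ 2 + s ^ 2 = 1) (hs : 0 < s)
    (hc : c ≠ 0) (hlam : 0 < lam) (hh : lam / s ≤ 1 / 4) (hB₁ : 1 / (4 * s) ≤ B)
    (hB₂ : 1 / (16 * s * |c|) ≤ B) {v : Fin 2 → ℝ} (hv : v ≠ 0) :
    ∃ K, ∀ N : ℕ, |cubeMean N (fun σ =>
        Real.log ‖WithLp.toLp 2 (transferB lam (2 * c) N σ *ᵥ v)‖) - N * ((lam / s) ^ 2 / 8)| ≤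
      K + N * ((17 + 12 * B) / 2 * (lam / s) ^ 3) := by
  set h := lam / s with hdef
  have hpos : 0 < h := by positivity
  set e : ℂ := ⟨c, s⟩ with he_def
  have he : ‖e‖ = 1 := by
    rw [← sq_eq_sq₀ (norm_nonneg _) zero_le_one, ← Complex.normSq_eq_norm_sq, he_def,
      Complex.normSq_mk]
    linarith
  have he0 : e ≠ 0 := norm_ne_zero_iff.mp (by rw [he]; exact one_ne_zero)
  have hsC : (s : ℂ) ≠ 0 := by exact_mod_cast hs.ne'
  have hcC : (c : ℂ) ≠ 0 := by exact_mod_cast hc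
  have e2 : e ^ 2 - 1 = 2 * Complex.I * s * e := by
    apply Complex.ext
    · simp [he_def, sq]; linarith
    · simp [he_def, sq]; ring
  have e2' : e ^ 2 + 1 = 2 * c * e := by
    apply Complex.ext
    · simp [he_def, sq]; linarith
    · simp [he_def, sq]; ring
  have e4 : e ^ 4 - 1 = 4 * Complex.I * s * c * e ^ 2 := by
    linear_combination (e ^ 2 + 1) * e2 + 2 * Complex.I * s * e * e2'
  set c₁ : ℂ := 1 / (4 * Complex.I * s * e) with hc₁
  set c₂ : ℂ := -1 / (16 * Complex.I * s * c * e ^ 2) with hc₂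
  have n₁ : ‖c₁‖ ≤ B := by
    rw [hc₁]; simpa [he, abs_of_pos hs] using hB₁
  have n₂ : ‖c₂‖ ≤ B := by
    rw [hc₂]; simpa [he, abs_of_pos hs] using hB₂
  have q₁ : c₁ * (e ^ 2 - 1) = 1 / 2 := by
    rw [e2, hc₁]; field_simp [Complex.I_ne_zero]; norm_num
  have q₂ : c₂ * (e ^ 4 - 1) = -1 / 4 := by
    rw [e4, hc₂]; field_simp [Complex.I_ne_zero]; norm_num
  obtain ⟨K, hK⟩ := abs_corrLog_prufer_sub_le hcs hs.ne' h c₁ c₂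
  refine ⟨(K + |corrLog h c₁ c₂ (prufer c s v)|) / 2, fun N => ?_⟩
  have growth := abs_cubeMean_transferB_sub_le (lam := lam) (E := 2 * c)
    (Φ := fun v => corrLog h c₁ c₂ (prufer c s v)) (fun w hw => by
      rw [prufer_gE_mulVec hcs hs.ne', prufer_gE_mulVec hcs hs.ne', mul_one, mul_neg_one]
      exact abs_mean_corrLog_sub_le hpos hh he q₁ q₂ n₁ n₂ (prufer_ne_zero hs.ne' hw)) hv N
  have compare := abs_cubeMean_le fun σ : Fin N → Bool =>
    hK _ (mulVec_ne_zero_of_det_eq_one (det_transferB lam (2 * c) N σ) hv)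
  rw [cubeMean_sub, cubeMean_const_mul] at compare
  obtain ⟨g1, g2⟩ := abs_le.mp growth
  obtain ⟨k1, k2⟩ := abs_le.mp compare
  have a1 := neg_abs_le (corrLog h c₁ c₂ (prufer c s v))
  have a2 := le_abs_self (corrLog h c₁ c₂ (prufer c s v))
  rw [abs_le]
  constructor <;> linarith

/-! ### The Lyapunov exponent -/

lemma le_of_tendsto_div_of_affine_le {a : ℕ → ℝ} {L K b : ℝ}
    (ha : Tendsto (fun N : ℕ => a N / N) atTop (nhds L)) (h : ∀ N : ℕ, a N ≤ K + N * b) :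
    L ≤ b := by
  have hlim : Tendsto (fun N : ℕ => K / N + b) atTop (nhds (0 + b)) :=
    (tendsto_const_div_atTop_nhds_zero_nat K).add tendsto_const_nhds
  rw [zero_add] at hlim
  refine le_of_tendsto_of_tendsto ha hlim ?_
  filter_upwards [eventually_gt_atTop 0] with N hN
  have hN' : (0 : ℝ) < N := by exact_mod_cast hN
  rw [div_le_iff₀ hN', add_mul, div_mul_cancel₀ _ hN'.ne', mul_comm b]
  exact h N

/-- The mean logarithmic norm of the transfer matrix. -/
def meanLogNorm (lam E : ℝ) (N : ℕ) : ℝ :=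
  cubeMean N fun σ => Real.log (opNorm (transferB lam E N σ))

lemma exists_tendsto_meanLogNorm_div (lam E : ℝ) :
    ∃ L, Tendsto (fun N : ℕ => meanLogNorm lam E N / N) atTop (nhds L) := by
  have hsub : Subadditive (meanLogNorm lam E) := fun m n => by
    rw [meanLogNorm, cubeMean_append]
    calc _ ≤ cubeMean m fun σ => cubeMean n fun τ =>
          Real.log (opNorm (transferB lam E n τ)) + Real.log (opNorm (transferB lam E m σ)) :=
          cubeMean_mono fun σ => cubeMean_mono fun τ => by
            rw [transferB_append]
            exact log_opNorm_mul_le (det_transferB ..) (det_transferB ..)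
      _ = _ := by
        simp only [cubeMean_add, cubeMean_const, meanLogNorm]
        rw [add_comm]
  refine ⟨hsub.lim, hsub.tendsto_lim ⟨0, ?_⟩⟩
  rintro _ ⟨N, rfl⟩
  refine div_nonneg ?_ N.cast_nonneg
  rw [← cubeMean_const N 0]
  exact cubeMean_mono fun σ => Real.log_nonneg (one_le_opNorm (det_transferB ..))

/-- If every fixed vector grows at rate `A` up to an error `R`, so does the norm. -/
lemma abs_lyapunov_sub_le {lam E L A R : ℝ}
    (hL : Tendsto (fun N : ℕ => meanLogNorm lam E N / N) atTop (nhds L))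
    (hv : ∀ v : Fin 2 → ℝ, v ≠ 0 → ∃ K, ∀ N : ℕ, |cubeMean N (fun σ =>
        Real.log ‖WithLp.toLp 2 (transferB lam E N σ *ᵥ v)‖) - N * A| ≤ K + N * R) :
    |L - A| ≤ R := by
  have lower : -L ≤ R - A := by
    obtain ⟨K, hK⟩ := hv ![1, 0] (by simp)
    refine le_of_tendsto_div_of_affine_le (a := fun N => -meanLogNorm lam E N) (K := K)
      (by simpa only [neg_div] using hL.neg) fun N => ?_
    have hle : cubeMean N (fun σ =>
        Real.log ‖WithLp.toLp 2 (transferB lam E N σ *ᵥ ![1, 0])‖) ≤ meanLogNorm lam E N :=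
      cubeMean_mono fun σ => by
        refine Real.log_le_log (norm_pos_iff.mpr ?_) ?_
        · simpa using mulVec_ne_zero_of_det_eq_one (det_transferB lam E N σ)
            (v := ![1, 0]) (by simp)
        · refine (norm_toLp_mulVec_le _ _).trans_eq ?_
          rw [norm_toLp_fin_two]
          simp
    linarith [(abs_le.mp (hK N)).1]
  have upper : ∀ k : ℕ, 0 < k → ((k : ℝ) - 2) * L ≤ k * (A + R) := by
    intro k hk
    choose K hK using fun j : ℕ => hv ![1, (j : ℝ)] (by simp)
    refine le_of_tendsto_div_of_affine_le (a := fun N => ((k : ℝ) - 2) * meanLogNorm lam E N)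
      (K := ∑ j ∈ Finset.range k, K j + ((k : ℝ) - 1) * Real.log (3 + 2 * k))
      (by simpa only [mul_div_assoc] using hL.const_mul ((k : ℝ) - 2)) fun N => ?_
    have hmean := cubeMean_mono fun σ => log_opNorm_le_sum (det_transferB lam E N σ) hk
    rw [cubeMean_sub, cubeMean_const_mul, cubeMean_const, cubeMean_sum] at hmean
    have hsum : ∑ j ∈ Finset.range k, cubeMean N (fun σ =>
        Real.log ‖WithLp.toLp 2 (transferB lam E N σ *ᵥ ![1, (j : ℝ)])‖) ≤
          ∑ j ∈ Finset.range k, (K j + N * (A + R)) :=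
      Finset.sum_le_sum fun j _ => by linarith [(abs_le.mp (hK j N)).2]
    rw [Finset.sum_add_distrib, Finset.sum_const, Finset.card_range, nsmul_eq_mul] at hsum
    change ((k : ℝ) - 2) * meanLogNorm lam E N - _ ≤ _ at hmean
    linarith
  refine abs_le.mpr ⟨by linarith, ?_⟩
  by_contra! hcon
  obtain ⟨k, hk⟩ := exists_nat_gt (2 * |L| / (L - A - R))
  have hgap : 0 < L - A - R := by linarith
  have hk0 : 0 < k := by
    have : (0 : ℝ) < k := lt_of_le_of_lt (by positivity) hk
    exact_mod_cast this
  rw [div_lt_iff₀ hgap] at hk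
  linarith [upper k hk0, le_abs_self L]

/-- **Figotin–Pastur asymptotics of the Lyapunov exponent.** For
`δ₀ < |E| < 2 - δ₀`, `E = 2 cos κ`, and small `λ`, the Lyapunov exponent
`L(E) = lim_N (1/N) 𝔼_ε log ‖M_N(E;ε)‖` exists and
`|L(E) - λ²/(8 sin² κ)| ≤ C λ³`, equivalently `|L(E) - λ²/(2(4 - E²))| ≤ C λ³`. -/
theorem lyapunov_figotin_pastur
    (δ₀ : ℝ) (hδ₀ : 0 < δ₀) (hδ₀' : δ₀ < 1) :
    ∃ C lam0 : ℝ, 0 < C ∧ 0 < lam0 ∧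
      ∀ lam : ℝ, 0 < lam → lam < lam0 →
        ∀ E κ : ℝ, δ₀ < |E| → |E| < 2 - δ₀ →
          E = 2 * Real.cos κ → 0 < κ → κ < Real.pi →
          ∃ L : ℝ,
            Tendsto
              (fun N : ℕ =>
                (∑ σ : Fin N → Bool, Real.log (opNorm (transferB lam E N σ))) /
                  2 ^ N / N)
              atTop (nhds L) ∧
            |L - lam ^ 2 / (8 * Real.sin κ ^ 2)| ≤ C * lam ^ 3 ∧
            |L - lam ^ 2 / (2 * (4 - E ^ 2))| ≤ C * lam ^ 3 := by
  refine ⟨(17 + 12 * (1 / δ₀ ^ 2)) / 2 * (2 / δ₀) ^ 3, δ₀ / 8, by positivity, by positivity,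
    fun lam hlam hlam0 E κ hE1 hE2 hE hκ0 hκπ => ?_⟩
  have hs : 0 < Real.sin κ := Real.sin_pos_of_pos_of_lt_pi hκ0 hκπ
  have hcs := Real.cos_sq_add_sin_sq κ
  rw [hE, abs_mul, abs_two] at hE1 hE2
  have hcpos : 0 < |Real.cos κ| := by linarith
  have hsl : δ₀ / 2 ≤ Real.sin κ := by
    nlinarith [sq_abs (Real.cos κ)]
  have hB₁ : 1 / (4 * Real.sin κ) ≤ 1 / δ₀ ^ 2 :=
    one_div_le_one_div_of_le (by positivity) (by nlinarith)
  have hB₂ : 1 / (16 * Real.sin κ * |Real.cos κ|) ≤ 1 / δ₀ ^ 2 :=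
    one_div_le_one_div_of_le (by positivity) (by nlinarith)
  have hh : lam / Real.sin κ ≤ 1 / 4 := by
    rw [div_le_iff₀ hs]; linarith
  obtain ⟨L, hL⟩ := exists_tendsto_meanLogNorm_div lam E
  have key : |L - lam ^ 2 / (8 * Real.sin κ ^ 2)| ≤
      (17 + 12 * (1 / δ₀ ^ 2)) / 2 * (2 / δ₀) ^ 3 * lam ^ 3 := by
    have hA : lam ^ 2 / (8 * Real.sin κ ^ 2) = (lam / Real.sin κ) ^ 2 / 8 := by
      rw [div_pow, div_div, mul_comm]
    rw [hA, mul_assoc, ← mul_pow]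
    refine (abs_lyapunov_sub_le hL fun v hv => ?_).trans
      (?_ : (17 + 12 * (1 / δ₀ ^ 2)) / 2 * (lam / Real.sin κ) ^ 3 ≤ _)
    · rw [hE]
      exact abs_cubeMean_log_norm_sub_le hcs hs (abs_pos.mp hcpos) hlam hh hB₁ hB₂ hv
    · gcongr
      rw [div_le_iff₀ hs]
      calc lam = 2 / δ₀ * lam * (δ₀ / 2) := by field_simp
        _ ≤ _ := by gcongr
  refine ⟨L, hL, key, ?_⟩
  have h4 : 2 * (4 - E ^ 2) = 8 * Real.sin κ ^ 2 := by
    rw [hE]; linear_combination (-8) * hcs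
  rwa [h4]
end
end

section
/- Fix δ₀ ∈ (0,1). There are constants C > 0 and λ₀ > 0 (depending only on δ₀) such that for all 0 < λ < λ₀, with N = ⌈λ^{−2}⌉, for every E with δ₀ < |E| < 2 − δ₀, every θ on the circle, and every t ∈ ℝ: mes[ ε ∈ {1,−1}^N : |τ_{M_N(E;ε)}(θ) − t| < λ e^{−C |log λ|^{1/2}} ] ≤ C λ. -/
noncomputable section

instance : Fact (0 < 2 * Real.pi) := ⟨by have := Real.pi_pos; linarith⟩

/-- The projective action `τ_g(θ)` of `g ∈ SL₂(ℝ)`, as a point of the circle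
`ℝ/2πℤ`: the argument of `(a cos θ + b sin θ) + i (c cos θ + d sin θ)`. -/
def tauC (g : Matrix (Fin 2) (Fin 2) ℝ) (θ : ℝ) : AddCircle (2 * Real.pi) :=
  ((Complex.arg ((g 0 0 * Real.cos θ + g 0 1 * Real.sin θ : ℝ) +
      Complex.I * (g 1 0 * Real.cos θ + g 1 1 * Real.sin θ : ℝ)) : ℝ) :
    AddCircle (2 * Real.pi))

/-- The lift to `ℝ` of the action on angles of the horizontal shear `(X, Y) ↦ (X - m Y, Y)`. -/
def shear (m ψ : ℝ) : ℝ :=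
  ψ + Real.arctan (m * Real.sin ψ ^ 2 / (1 - m * Real.sin ψ * Real.cos ψ))

/-- The squared length of the image of the unit vector of angle `ψ` under the shear
`(X, Y) ↦ (X - m Y, Y)`. -/
def stretch (m ψ : ℝ) : ℝ :=
  1 - 2 * m * Real.sin ψ * Real.cos ψ + m ^ 2 * Real.sin ψ ^ 2

/-- The trajectory of `x` under a two-letter random dynamical system. -/
def orbit {X : Type*} (step : Bool → X → X) (x : X) (ω : ℕ → Bool) : ℕ → X
  | 0 => x
  | k + 1 => step (ω k) (orbit step x ω k)

/-- A rotation by `κ` followed by a shear by `± m`, in lifted polar coordinates. -/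
def polarStep (m κ : ℝ) (b : Bool) (s : ℝ × ℝ) : ℝ × ℝ :=
  (shear (bval b * m) (s.1 + κ), s.2 * √(stretch (bval b * m) (s.1 + κ)))

/-- Extension of a finite Boolean word to an infinite one. -/
def padded {N : ℕ} (σ : Fin N → Bool) (k : ℕ) : Bool :=
  if h : k < N then σ ⟨k, h⟩ else true

/-- The word with its `j`-th letter negated. -/
def flipAt {N : ℕ} (j : Fin N) (σ : Fin N → Bool) : Fin N → Bool :=
  Function.update σ j (!σ j)

section Shear

lemma abs_sin_mul_cos_le (ψ : ℝ) : |Real.sin ψ * Real.cos ψ| ≤ 1 / 2 := by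
  rw [abs_le]
  constructor <;> nlinarith [Real.sin_sq_add_cos_sq ψ, sq_nonneg (Real.sin ψ + Real.cos ψ),
    sq_nonneg (Real.sin ψ - Real.cos ψ)]

lemma shear_denom_ge {m : ℝ} (hm : |m| ≤ 1 / 8) (ψ : ℝ) :
    1 / 2 ≤ 1 - m * Real.sin ψ * Real.cos ψ := by
  have h := abs_sin_mul_cos_le ψ
  have : |m * Real.sin ψ * Real.cos ψ| ≤ 1 / 8 * (1 / 2) := by
    rw [mul_assoc, abs_mul]
    gcongr
  linarith [(abs_le.1 this).2]

lemma stretch_eq (m ψ : ℝ) :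
    stretch m ψ = (1 - m * Real.sin ψ * Real.cos ψ) ^ 2 + (m * Real.sin ψ ^ 2) ^ 2 := by
  have h := Real.sin_sq_add_cos_sq ψ
  unfold stretch
  linear_combination (-(m ^ 2 * Real.sin ψ ^ 2)) * h

lemma stretch_pos {m : ℝ} (hm : |m| ≤ 1 / 8) (ψ : ℝ) : 0 < stretch m ψ := by
  have := shear_denom_ge hm ψ
  rw [stretch_eq]
  positivity

lemma sqrt_stretch_eq {m : ℝ} (hm : |m| ≤ 1 / 8) (ψ : ℝ) :
    √(stretch m ψ) = (1 - m * Real.sin ψ * Real.cos ψ) *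
      √(1 + (m * Real.sin ψ ^ 2 / (1 - m * Real.sin ψ * Real.cos ψ)) ^ 2) := by
  have h := shear_denom_ge hm ψ
  have h0 : 0 < 1 - m * Real.sin ψ * Real.cos ψ := by linarith
  rw [Real.sqrt_eq_iff_mul_self_eq (stretch_pos hm ψ).le (by positivity), stretch_eq]
  rw [mul_mul_mul_comm, Real.mul_self_sqrt (by positivity)]
  field_simp

lemma sqrt_stretch_mul_cos_shear {m : ℝ} (hm : |m| ≤ 1 / 8) (ψ : ℝ) :
    √(stretch m ψ) * Real.cos (shear m ψ) = Real.cos ψ - m * Real.sin ψ := by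
  have h := shear_denom_ge hm ψ
  have h0 : 0 < 1 - m * Real.sin ψ * Real.cos ψ := by linarith
  have hs := Real.sin_sq_add_cos_sq ψ
  rw [sqrt_stretch_eq hm, shear, Real.cos_add, Real.cos_arctan, Real.sin_arctan]
  set f := m * Real.sin ψ ^ 2 / (1 - m * Real.sin ψ * Real.cos ψ) with hf
  have hf' : f * (1 - m * Real.sin ψ * Real.cos ψ) = m * Real.sin ψ ^ 2 := by
    rw [hf]; field_simp
  have : √(1 + f ^ 2) ≠ 0 := by positivity
  field_simp
  linear_combination (-Real.sin ψ) * hf' - (m * Real.sin ψ) * hs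

lemma sqrt_stretch_mul_sin_shear {m : ℝ} (hm : |m| ≤ 1 / 8) (ψ : ℝ) :
    √(stretch m ψ) * Real.sin (shear m ψ) = Real.sin ψ := by
  have h := shear_denom_ge hm ψ
  have h0 : 0 < 1 - m * Real.sin ψ * Real.cos ψ := by linarith
  rw [sqrt_stretch_eq hm, shear, Real.sin_add, Real.cos_arctan, Real.sin_arctan]
  set f := m * Real.sin ψ ^ 2 / (1 - m * Real.sin ψ * Real.cos ψ) with hf
  have hf' : f * (1 - m * Real.sin ψ * Real.cos ψ) = m * Real.sin ψ ^ 2 := by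
    rw [hf]; field_simp
  have : √(1 + f ^ 2) ≠ 0 := by positivity
  field_simp
  linear_combination (Real.cos ψ) * hf'

lemma abs_arctan_sub_le (x y : ℝ) : |Real.arctan x - Real.arctan y| ≤ |x - y| := by
  have h : ∀ z ∈ (Set.univ : Set ℝ), ‖deriv Real.arctan z‖ ≤ 1 := fun z _ => by
    rw [Real.deriv_arctan, Real.norm_eq_abs, abs_of_nonneg (by positivity),
      div_le_one (by positivity)]
    nlinarith [sq_nonneg z]
  simpa using convex_univ.norm_image_sub_le_of_norm_deriv_le
    (fun z _ => Real.differentiableAt_arctan z) h (Set.mem_univ y) (Set.mem_univ x)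

lemma abs_shear_ratio_le {m : ℝ} (hm : |m| ≤ 1 / 8) (ψ : ℝ) :
    |m * Real.sin ψ ^ 2 / (1 - m * Real.sin ψ * Real.cos ψ)| ≤ 2 * |m| := by
  have h := shear_denom_ge hm ψ
  have h0 : 0 < 1 - m * Real.sin ψ * Real.cos ψ := by linarith
  rw [abs_div, abs_of_pos h0, div_le_iff₀ h0, abs_mul, abs_of_nonneg (sq_nonneg (Real.sin ψ))]
  have := Real.sin_sq_le_one ψ
  nlinarith [abs_nonneg m]

lemma abs_shear_sub_le {m : ℝ} (hm : |m| ≤ 1 / 8) (ψ : ℝ) : |shear m ψ - ψ| ≤ 2 * |m| := by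
  have : shear m ψ - ψ =
    Real.arctan (m * Real.sin ψ ^ 2 / (1 - m * Real.sin ψ * Real.cos ψ)) := by
      unfold shear; ring
  rw [this]
  refine le_trans ?_ (abs_shear_ratio_le hm ψ)
  simpa using abs_arctan_sub_le (m * Real.sin ψ ^ 2 / (1 - m * Real.sin ψ * Real.cos ψ)) 0

lemma shear_neg_le_shear {m : ℝ} (hm0 : 0 ≤ m) (hm : |m| ≤ 1 / 8) (ψ : ℝ) :
    shear (-m) ψ ≤ shear m ψ := by
  have h1 := shear_denom_ge hm ψ
  have h2 := shear_denom_ge (m := -m) (by rwa [abs_neg]) ψ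
  have e1 : -m * Real.sin ψ ^ 2 / (1 - -m * Real.sin ψ * Real.cos ψ) ≤ 0 :=
    div_nonpos_of_nonpos_of_nonneg (by nlinarith [sq_nonneg (Real.sin ψ)]) (by linarith)
  have e2 : 0 ≤ m * Real.sin ψ ^ 2 / (1 - m * Real.sin ψ * Real.cos ψ) :=
    div_nonneg (by positivity) (by linarith)
  unfold shear
  linarith [Real.arctan_mono (e1.trans e2)]

/-- Shears preserve the area spanned by two vectors. -/
lemma stretch_mul_sin_shear_sub {m : ℝ} (hm : |m| ≤ 1 / 8) (ψ₁ ψ₂ : ℝ) :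
    √(stretch m ψ₁) * √(stretch m ψ₂) * Real.sin (shear m ψ₁ - shear m ψ₂) =
      Real.sin (ψ₁ - ψ₂) := by
  rw [Real.sin_sub, Real.sin_sub]
  have c1 := sqrt_stretch_mul_cos_shear hm ψ₁
  have c2 := sqrt_stretch_mul_cos_shear hm ψ₂
  have s1 := sqrt_stretch_mul_sin_shear hm ψ₁
  have s2 := sqrt_stretch_mul_sin_shear hm ψ₂
  calc _ = (√(stretch m ψ₁) * Real.sin (shear m ψ₁)) * (√(stretch m ψ₂) * Real.cos (shear m ψ₂))
        - (√(stretch m ψ₁) * Real.cos (shear m ψ₁)) * (√(stretch m ψ₂) * Real.sin (shear m ψ₂)) := by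
          ring
    _ = _ := by rw [c1, c2, s1, s2]; ring

/-- The area spanned by the images of one vector under two opposite shears. -/
lemma stretch_mul_sin_shear_sub_neg {m : ℝ} (hm : |m| ≤ 1 / 8) (ψ : ℝ) :
    √(stretch m ψ) * √(stretch (-m) ψ) * Real.sin (shear m ψ - shear (-m) ψ) =
      2 * m * Real.sin ψ ^ 2 := by
  rw [Real.sin_sub]
  have hm' : |-m| ≤ 1 / 8 := by rwa [abs_neg]
  have c1 := sqrt_stretch_mul_cos_shear hm ψ
  have c2 := sqrt_stretch_mul_cos_shear hm' ψ
  have s1 := sqrt_stretch_mul_sin_shear hm ψ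
  have s2 := sqrt_stretch_mul_sin_shear hm' ψ
  calc _ = (√(stretch m ψ) * Real.sin (shear m ψ)) *
          (√(stretch (-m) ψ) * Real.cos (shear (-m) ψ))
        - (√(stretch m ψ) * Real.cos (shear m ψ)) *
          (√(stretch (-m) ψ) * Real.sin (shear (-m) ψ)) := by ring
    _ = _ := by rw [c1, c2, s1, s2]; ring

lemma shear_mono {m : ℝ} (hm : |m| ≤ 1 / 8) : Monotone (shear m) := by
  intro ψ₁ ψ₂ h
  have a1 := abs_le.1 (abs_shear_sub_le hm ψ₁)
  have a2 := abs_le.1 (abs_shear_sub_le hm ψ₂)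
  by_contra! hlt
  have hpi := Real.pi_gt_three
  have hs := stretch_mul_sin_shear_sub hm ψ₁ ψ₂
  have p1 : 0 < √(stretch m ψ₁) := Real.sqrt_pos.2 (stretch_pos hm ψ₁)
  have p2 : 0 < √(stretch m ψ₂) := Real.sqrt_pos.2 (stretch_pos hm ψ₂)
  have pos : 0 < Real.sin (shear m ψ₁ - shear m ψ₂) :=
    Real.sin_pos_of_pos_of_lt_pi (by linarith) (by linarith)
  have nonpos : Real.sin (ψ₁ - ψ₂) ≤ 0 :=
    Real.sin_nonpos_of_nonpos_of_neg_pi_le (by linarith) (by linarith)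
  have : 0 < Real.sin (ψ₁ - ψ₂) := by rw [← hs]; positivity
  linarith

/-- Opposite shears have opposite displacements up to second order. -/
lemma abs_shear_add_shear_neg_le {m : ℝ} (hm : |m| ≤ 1 / 8) (ψ : ℝ) :
    |(shear m ψ - ψ) + (shear (-m) ψ - ψ)| ≤ 4 * m ^ 2 := by
  have h1 := shear_denom_ge hm ψ
  have h2 := shear_denom_ge (m := -m) (by rwa [abs_neg]) ψ
  have e : (shear m ψ - ψ) + (shear (-m) ψ - ψ) =
      Real.arctan (m * Real.sin ψ ^ 2 / (1 - m * Real.sin ψ * Real.cos ψ)) -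
      Real.arctan (m * Real.sin ψ ^ 2 / (1 - -m * Real.sin ψ * Real.cos ψ)) := by
    unfold shear
    rw [neg_mul m (Real.sin ψ ^ 2), neg_div, Real.arctan_neg]
    ring
  rw [e]
  refine (abs_arctan_sub_le _ _).trans ?_
  set q₁ := 1 - m * Real.sin ψ * Real.cos ψ with hq₁
  set q₂ := 1 - -m * Real.sin ψ * Real.cos ψ with hq₂
  have hq₁' : 0 < q₁ := by linarith
  have hq₂' : 0 < q₂ := by linarith
  have e2 : m * Real.sin ψ ^ 2 / q₁ - m * Real.sin ψ ^ 2 / q₂ =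
      m ^ 2 * (2 * Real.sin ψ ^ 2 * (Real.sin ψ * Real.cos ψ)) / (q₁ * q₂) := by
    rw [div_sub_div _ _ hq₁'.ne' hq₂'.ne', hq₁, hq₂]
    ring
  rw [e2, abs_div, abs_of_pos (mul_pos hq₁' hq₂'), div_le_iff₀ (by positivity), abs_mul, abs_mul,
    abs_of_nonneg (sq_nonneg m), abs_of_nonneg (by positivity : 0 ≤ 2 * Real.sin ψ ^ 2)]
  have hsc := abs_sin_mul_cos_le ψ
  have hs := Real.sin_sq_le_one ψ
  have hq : 1 / 4 ≤ q₁ * q₂ := by nlinarith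
  have h3 : 2 * Real.sin ψ ^ 2 * |Real.sin ψ * Real.cos ψ| ≤ 1 := by
    nlinarith [abs_nonneg (Real.sin ψ * Real.cos ψ), sq_nonneg (Real.sin ψ)]
  nlinarith [sq_nonneg m]

/-- One step of the second moment estimate for the displacement of the angle. -/
lemma sq_add_shear_le {m : ℝ} (hm : |m| ≤ 1 / 8) (ψ D : ℝ) :
    (1 + (D + (shear m ψ - ψ)) ^ 2) + (1 + (D + (shear (-m) ψ - ψ)) ^ 2) ≤
      2 * (1 + 8 * m ^ 2) * (1 + D ^ 2) := by
  have h1 := abs_shear_sub_le hm ψ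
  have h2 := abs_shear_sub_le (m := -m) (by rwa [abs_neg]) ψ
  have h3 := abs_shear_add_shear_neg_le hm ψ
  rw [abs_neg] at h2
  generalize shear m ψ - ψ = a at *
  generalize shear (-m) ψ - ψ = b at *
  have ha : a ^ 2 ≤ 4 * m ^ 2 := by
    calc a ^ 2 = |a| ^ 2 := (sq_abs a).symm
      _ ≤ (2 * |m|) ^ 2 := by gcongr
      _ = 4 * m ^ 2 := by rw [mul_pow, sq_abs]; norm_num
  have hb : b ^ 2 ≤ 4 * m ^ 2 := by
    calc b ^ 2 = |b| ^ 2 := (sq_abs b).symm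
      _ ≤ (2 * |m|) ^ 2 := by gcongr
      _ = 4 * m ^ 2 := by rw [mul_pow, sq_abs]; norm_num
  have hD : D * (a + b) ≤ |D| * (4 * m ^ 2) := by
    calc D * (a + b) ≤ |D * (a + b)| := le_abs_self _
      _ = |D| * |a + b| := abs_mul _ _
      _ ≤ _ := by gcongr
  have hD' : 2 * |D| ≤ 1 + D ^ 2 := by nlinarith [sq_nonneg (|D| - 1), sq_abs D]
  nlinarith [sq_nonneg m, sq_nonneg D, mul_nonneg (sq_nonneg m) (sq_nonneg D)]

lemma pow_add_pow_le_exp {f g a b m : ℝ} (n : ℕ) (hf0 : 0 ≤ f) (hg0 : 0 ≤ g)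
    (hf : f ≤ Real.exp (a + b)) (hg : g ≤ Real.exp (-a + b)) (ha : |a| ≤ |m|)
    (hb : b ≤ 4 * m ^ 2) : f ^ n + g ^ n ≤ 2 * Real.exp (5 * n ^ 2 * m ^ 2) := by
  have hf' : f ^ n ≤ Real.exp (n * b) * Real.exp (n * a) := by
    calc f ^ n ≤ Real.exp (a + b) ^ n := by gcongr
      _ = _ := by rw [← Real.exp_nat_mul, ← Real.exp_add]; ring_nf
  have hg' : g ^ n ≤ Real.exp (n * b) * Real.exp (-(n * a)) := by
    calc g ^ n ≤ Real.exp (-a + b) ^ n := by gcongr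
      _ = _ := by rw [← Real.exp_nat_mul, ← Real.exp_add]; ring_nf
  have hc := Real.cosh_le_exp_half_sq (n * a)
  have ha2 : a ^ 2 ≤ m ^ 2 := sq_le_sq.2 ha
  have hn : (n : ℝ) ≤ n ^ 2 := by exact_mod_cast Nat.le_self_pow two_ne_zero n
  calc f ^ n + g ^ n ≤ Real.exp (n * b) * (2 * Real.cosh (n * a)) := by
        rw [Real.cosh_eq]; linarith
    _ ≤ Real.exp (n * b) * (2 * Real.exp ((n * a) ^ 2 / 2)) := by gcongr
    _ = 2 * Real.exp (n * b + (n * a) ^ 2 / 2) := by rw [Real.exp_add]; ring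
    _ ≤ 2 * Real.exp (5 * n ^ 2 * m ^ 2) := by
        gcongr
        have h1 : n * b ≤ n ^ 2 * (4 * m ^ 2) := by
          calc n * b ≤ n * (4 * m ^ 2) := by gcongr
            _ ≤ _ := by gcongr
        have h2 : (n * a) ^ 2 ≤ n ^ 2 * m ^ 2 := by rw [mul_pow]; gcongr
        nlinarith [mul_nonneg (sq_nonneg (n : ℝ)) (sq_nonneg m)]

lemma stretch_pow_add_le {m : ℝ} (hm : |m| ≤ 1 / 8) (n : ℕ) (ψ : ℝ) :
    stretch m ψ ^ n + stretch (-m) ψ ^ n ≤ 2 * Real.exp (5 * n ^ 2 * m ^ 2) := by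
  have hsc := abs_sin_mul_cos_le ψ
  refine pow_add_pow_le_exp (a := -(2 * m * (Real.sin ψ * Real.cos ψ)))
    (b := m ^ 2 * Real.sin ψ ^ 2) n (stretch_pos hm ψ).le
    (stretch_pos (by rwa [abs_neg]) ψ).le ?_ ?_ ?_ ?_
  · refine le_of_eq_of_le ?_ (Real.add_one_le_exp _)
    unfold stretch; ring
  · refine le_of_eq_of_le ?_ (Real.add_one_le_exp _)
    unfold stretch; ring
  · rw [abs_neg, abs_mul, abs_mul, abs_two]
    nlinarith [abs_nonneg m]
  · nlinarith [sq_nonneg m, Real.sin_sq_le_one ψ]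

lemma inv_one_add_le_exp {x : ℝ} (hx : -(1 / 2) ≤ x) : (1 + x)⁻¹ ≤ Real.exp (-x + 2 * x ^ 2) := by
  have h := Real.add_one_le_exp (-x + 2 * x ^ 2)
  refine le_trans ?_ h
  rw [inv_le_iff_one_le_mul₀ (by linarith)]
  nlinarith [mul_nonneg (sq_nonneg x) (by linarith : 0 ≤ 1 + 2 * x)]

lemma stretch_inv_pow_add_le {m : ℝ} (hm : |m| ≤ 1 / 8) (n : ℕ) (ψ : ℝ) :
    (stretch m ψ)⁻¹ ^ n + (stretch (-m) ψ)⁻¹ ^ n ≤ 2 * Real.exp (5 * n ^ 2 * m ^ 2) := by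
  have hsc := abs_sin_mul_cos_le ψ
  have hs := Real.sin_sq_le_one ψ
  have ha : |2 * m * (Real.sin ψ * Real.cos ψ)| ≤ |m| := by
    rw [abs_mul, abs_mul, abs_two]
    nlinarith [abs_nonneg m]
  have hb : m ^ 2 * Real.sin ψ ^ 2 ≤ m ^ 2 := by nlinarith [sq_nonneg m]
  have hb0 : 0 ≤ m ^ 2 * Real.sin ψ ^ 2 := by positivity
  have e1 : stretch m ψ =
      1 + (-(2 * m * (Real.sin ψ * Real.cos ψ)) + m ^ 2 * Real.sin ψ ^ 2) := by
    unfold stretch; ring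
  have e2 : stretch (-m) ψ =
      1 + (2 * m * (Real.sin ψ * Real.cos ψ) + m ^ 2 * Real.sin ψ ^ 2) := by
    unfold stretch; ring
  have hm2 : m ^ 2 ≤ 1 / 64 := by rw [← sq_abs]; nlinarith [abs_nonneg m]
  have p1 := stretch_pos hm ψ
  have p2 := stretch_pos (m := -m) (by rwa [abs_neg]) ψ
  rw [e1] at p1 ⊢
  rw [e2] at p2 ⊢
  have ha' := abs_le.1 (ha.trans hm)
  have ha2 : (2 * m * (Real.sin ψ * Real.cos ψ)) ^ 2 ≤ m ^ 2 := sq_le_sq.2 ha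
  generalize 2 * m * (Real.sin ψ * Real.cos ψ) = a at *
  generalize m ^ 2 * Real.sin ψ ^ 2 = b at *
  refine pow_add_pow_le_exp (a := a) (b := 4 * m ^ 2) n (by positivity) (by positivity)
    ((inv_one_add_le_exp (by linarith)).trans ?_) ((inv_one_add_le_exp (by linarith)).trans ?_)
    ha le_rfl
  · refine Real.exp_le_exp.2 ?_
    nlinarith [mul_nonneg hb0 (by linarith : 0 ≤ 1 + 4 * a - 2 * b)]
  · refine Real.exp_le_exp.2 ?_
    nlinarith [mul_nonneg hb0 (by linarith : 0 ≤ 1 - 4 * a - 2 * b)]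

end Shear

section Cube

variable {N : ℕ}

lemma padded_flipAt (j : Fin N) (σ : Fin N → Bool) :
    padded (flipAt j σ) = Function.update (padded σ) j (!padded σ j) := by
  funext k
  unfold padded flipAt
  by_cases hk : k < N
  · by_cases hkj : k = j
    · subst hkj; simp
    · have : (⟨k, hk⟩ : Fin N) ≠ j := fun h => hkj (by rw [← h])
      simp [hk, hkj, this]
  · have : k ≠ j := fun h => hk (by rw [h]; exact j.2)
    simp [hk, this]

lemma flipAt_involutive (j : Fin N) : Function.Involutive (flipAt j) := by
  intro σ
  simp [flipAt]

lemma sum_flipAt (j : Fin N) (F : (Fin N → Bool) → ℝ) : ∑ σ, F (flipAt j σ) = ∑ σ, F σ :=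
  Equiv.sum_comp (flipAt_involutive j).toPerm F

lemma bval_not (b : Bool) : bval (!b) = -bval b := by cases b <;> simp [bval]

/-- Twice the covariance of `F` with a letter is the total variation of `F` along this letter. -/
lemma sum_mul_bval (j : Fin N) (F : (Fin N → Bool) → ℝ) :
    2 * ∑ σ, F σ * bval (σ j) = ∑ σ, (F σ - F (flipAt j σ)) * bval (σ j) := by
  have h := sum_flipAt j fun σ => F σ * bval (σ j)
  have e : ∀ σ : Fin N → Bool, flipAt j σ j = !σ j := fun σ => by simp [flipAt]
  simp only [e, bval_not] at h
  simp only [sub_mul, Finset.sum_sub_distrib]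
  simp only [mul_neg, Finset.sum_neg_distrib] at h
  linarith

lemma orbit_update_of_le {X : Type*} (step : Bool → X → X) (x : X) (ω : ℕ → Bool) (j : ℕ)
    (b : Bool) {k : ℕ} (hk : k ≤ j) :
    orbit step x (Function.update ω j b) k = orbit step x ω k := by
  induction k with
  | zero => rfl
  | succ k ih =>
    have : k ≠ j := by omega
    simp [orbit, ih (by omega), this]

/-- If one step of a random dynamical system multiplies `V` by at most `c` on average, then `k`
steps multiply it by at most `c ^ k` on average. -/
lemma sum_orbit_le {X : Type*} (step : Bool → X → X) (V : ℕ → X → ℝ) {c : ℝ}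
    (hc : 0 ≤ c) (h : ∀ k x, V (k + 1) (step true x) + V (k + 1) (step false x) ≤ 2 * c * V k x)
    (x : X) {k : ℕ} (hk : k ≤ N) :
    ∑ σ : Fin N → Bool, V k (orbit step x (padded σ) k) ≤ c ^ k * V 0 x * 2 ^ N := by
  induction k with
  | zero => simp [orbit, mul_comm]
  | succ k ih =>
    have hkN : k < N := hk
    have h1 := sum_flipAt ⟨k, hkN⟩ fun σ => V (k + 1) (orbit step x (padded σ) (k + 1))
    have h2 : ∀ σ : Fin N → Bool, V (k + 1) (orbit step x (padded (flipAt ⟨k, hkN⟩ σ)) (k + 1)) +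
        V (k + 1) (orbit step x (padded σ) (k + 1)) ≤ 2 * c * V k (orbit step x (padded σ) k) := by
      intro σ
      have h3 := h k (orbit step x (padded σ) k)
      rw [padded_flipAt]
      simp only [orbit, Function.update_self, orbit_update_of_le step x (padded σ) k _ le_rfl]
      cases padded σ k <;> simp only [Bool.not_true, Bool.not_false] <;> linarith
    have h4 := Finset.sum_le_sum fun σ (_ : σ ∈ Finset.univ) => h2 σ
    rw [Finset.sum_add_distrib, h1, ← Finset.mul_sum] at h4
    have h5 := mul_le_mul_of_nonneg_left (ih hkN.le) hc
    calc _ ≤ c * ∑ σ : Fin N → Bool, V k (orbit step x (padded σ) k) := by linarith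
      _ ≤ _ := h5.trans_eq (by ring)

lemma orbit_sum_eq (σ : Fin N → Bool) :
    orbit (fun b (x : ℝ) => x + bval b) 0 (padded σ) N = ∑ j, bval (σ j) := by
  have h : ∀ k, orbit (fun b (x : ℝ) => x + bval b) 0 (padded σ) k =
      ∑ i ∈ Finset.range k, bval (padded σ i) := by
    intro k
    induction k with
    | zero => rfl
    | succ k ih => rw [orbit, ih, Finset.sum_range_succ]
  rw [h, Finset.sum_range]
  simp [padded]

lemma sum_sq_sum_bval_le (hN : 0 < N) :
    ∑ σ : Fin N → Bool, (∑ j, bval (σ j)) ^ 2 ≤ 3 * N * 2 ^ N := by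
  have hN' : (0 : ℝ) < N := by exact_mod_cast hN
  have h := sum_orbit_le (N := N) (fun b (x : ℝ) => x + bval b) (fun _ x => N + x ^ 2)
    (c := 1 + 1 / N) (by positivity) (fun _ x => by
      have : 2 * (1 + 1 / (N : ℝ)) * (N + x ^ 2) = 2 * (N + x ^ 2) + 2 + 2 * x ^ 2 / N := by
        field_simp
        ring
      have h0 : 0 ≤ 2 * x ^ 2 / N := by positivity
      simp only [bval, if_true, Bool.false_eq_true, if_false]
      nlinarith) 0 le_rfl
  have he : (1 + 1 / (N : ℝ)) ^ N ≤ 3 := by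
    calc (1 + 1 / (N : ℝ)) ^ N ≤ Real.exp (1 / N) ^ N := by
          gcongr
          linarith [Real.add_one_le_exp (1 / (N : ℝ))]
      _ = Real.exp 1 := by rw [← Real.exp_nat_mul]; congr 1; field_simp
      _ ≤ 3 := by linarith [Real.exp_one_lt_d9]
  simp only [orbit_sum_eq] at h
  calc _ ≤ ∑ σ : Fin N → Bool, ((N : ℝ) + (∑ j, bval (σ j)) ^ 2) := by
        gcongr; linarith
    _ ≤ _ := h
    _ = (1 + 1 / (N : ℝ)) ^ N * (N * 2 ^ N) := by ring
    _ ≤ 3 * (N * 2 ^ N) := by gcongr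
    _ = _ := by ring

/-- The total influence of a function on the cube is controlled by its second moment. -/
lemma sum_influence_le (hN : 0 < N) (G : (Fin N → Bool) → ℝ) (a : ℝ) {A : ℝ}
    (hG : ∑ σ, (G σ - a) ^ 2 ≤ A * 2 ^ N) :
    ∑ j, ∑ σ, (G σ - G (flipAt j σ)) * bval (σ j) ≤ √N * (A + 3) * 2 ^ N := by
  have hN' : 0 < √(N : ℝ) := Real.sqrt_pos.2 (by exact_mod_cast hN)
  have hsq : √(N : ℝ) * √(N : ℝ) = N := Real.mul_self_sqrt (by positivity)
  have h1 : ∀ j : Fin N, ∑ σ, (G σ - G (flipAt j σ)) * bval (σ j) =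
      2 * ∑ σ, (G σ - a) * bval (σ j) := by
    intro j
    rw [sum_mul_bval j fun σ => G σ - a]
    simp
  simp only [h1]
  rw [← Finset.mul_sum, Finset.sum_comm]
  simp only [← Finset.mul_sum]
  have h2 : ∀ σ : Fin N → Bool, 2 * ((G σ - a) * ∑ j, bval (σ j)) ≤
      √N * (G σ - a) ^ 2 + (∑ j, bval (σ j)) ^ 2 / √N := by
    intro σ
    generalize ∑ j, bval (σ j) = T
    have : √N * (G σ - a) ^ 2 + T ^ 2 / √N - 2 * ((G σ - a) * T) =
        (√N * (G σ - a) - T) ^ 2 / √N := by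
      field_simp
      ring
    have h0 : 0 ≤ (√N * (G σ - a) - T) ^ 2 / √N := by positivity
    linarith
  have h3 := sum_sq_sum_bval_le hN
  calc _ ≤ ∑ σ, (√N * (G σ - a) ^ 2 + (∑ j, bval (σ j)) ^ 2 / √N) := by
        rw [Finset.mul_sum]
        exact Finset.sum_le_sum fun σ _ => h2 σ
    _ = √N * ∑ σ, (G σ - a) ^ 2 + (∑ σ : Fin N → Bool, (∑ j, bval (σ j)) ^ 2) / √N := by
        rw [Finset.sum_add_distrib, Finset.mul_sum, Finset.sum_div]
    _ ≤ √N * (A * 2 ^ N) + (3 * N * 2 ^ N) / √N := by gcongr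
    _ = _ := by
        have : 3 * (N : ℝ) * 2 ^ N / √N = √N * 3 * 2 ^ N := by
          rw [div_eq_iff hN'.ne']
          linear_combination (-3 * 2 ^ N) * hsq
        rw [this]
        ring

end Cube

section Polar

variable {m κ : ℝ}

lemma abs_bval_mul (b : Bool) (m : ℝ) : |bval b * m| = |m| := by
  cases b <;> simp [bval]

lemma orbit_polarStep_snd_pos (hm : |m| ≤ 1 / 8) {s : ℝ × ℝ} (hs : 0 < s.2) (ω : ℕ → Bool)
    (k : ℕ) : 0 < (orbit (polarStep m κ) s ω k).2 := by
  induction k with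
  | zero => exact hs
  | succ k ih =>
    exact mul_pos ih (Real.sqrt_pos.2 (stretch_pos (by rwa [abs_bval_mul]) _))

/-- Changing a letter from `-1` to `1` increases all later angles, and the area spanned by the two
resulting vectors does not depend on the time. -/
lemma orbit_update_compare (hm0 : 0 ≤ m) (hm : |m| ≤ 1 / 8) (s : ℝ × ℝ) (ω : ℕ → Bool) {j k : ℕ}
    (hjk : j + 1 ≤ k) :
    (orbit (polarStep m κ) s (Function.update ω j false) k).1 ≤
        (orbit (polarStep m κ) s (Function.update ω j true) k).1 ∧
      (orbit (polarStep m κ) s (Function.update ω j true) k).2 *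
        (orbit (polarStep m κ) s (Function.update ω j false) k).2 *
        Real.sin ((orbit (polarStep m κ) s (Function.update ω j true) k).1 -
          (orbit (polarStep m κ) s (Function.update ω j false) k).1) =
      2 * m * (orbit (polarStep m κ) s ω j).2 ^ 2 *
        Real.sin ((orbit (polarStep m κ) s ω j).1 + κ) ^ 2 := by
  induction k, hjk using Nat.le_induction with
  | base =>
    simp only [orbit, Function.update_self, orbit_update_of_le _ _ _ _ _ le_rfl, polarStep, bval,
      if_true, Bool.false_eq_true, if_false, one_mul, neg_one_mul]
    refine ⟨shear_neg_le_shear hm0 hm _, ?_⟩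
    linear_combination (orbit (polarStep m κ) s ω j).2 ^ 2 *
      stretch_mul_sin_shear_sub_neg hm ((orbit (polarStep m κ) s ω j).1 + κ)
  | succ k hk ih =>
    have hne : k ≠ j := by omega
    simp only [orbit, Function.update_of_ne hne]
    generalize orbit (polarStep m κ) s (Function.update ω j true) k = x at *
    generalize orbit (polarStep m κ) s (Function.update ω j false) k = y at *
    have hm' : |bval (ω k) * m| ≤ 1 / 8 := by rwa [abs_bval_mul]
    refine ⟨shear_mono hm' (by linarith [ih.1]), ?_⟩
    rw [← ih.2]
    have h := stretch_mul_sin_shear_sub hm' (x.1 + κ) (y.1 + κ)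
    rw [add_sub_add_right_eq_sub] at h
    rw [← h]
    simp only [polarStep]
    ring

lemma abs_sin_sub_le (x y : ℝ) : |Real.sin (x - y)| ≤ |Real.sin x| + |Real.sin y| := by
  rw [Real.sin_sub]
  refine (abs_sub _ _).trans ?_
  rw [abs_mul, abs_mul]
  have h1 := Real.abs_cos_le_one x
  have h2 := Real.abs_cos_le_one y
  gcongr
  · exact mul_le_of_le_one_right (abs_nonneg _) h2
  · exact mul_le_of_le_one_left (abs_nonneg _) h1

/-- The angle cannot be close to a multiple of `π` at two consecutive times. -/
lemma sin_le_consecutive (hm : |m| ≤ 1 / 8) (s : ℝ × ℝ) (ω : ℕ → Bool) (k : ℕ) :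
    Real.sin κ ≤ |Real.sin ((orbit (polarStep m κ) s ω k).1 + κ)| +
      |Real.sin ((orbit (polarStep m κ) s ω (k + 1)).1 + κ)| + 2 * |m| := by
  simp only [orbit]
  generalize orbit (polarStep m κ) s ω k = x
  have hm' : |bval (ω k) * m| ≤ 1 / 8 := by rwa [abs_bval_mul]
  have h := abs_shear_sub_le hm' (x.1 + κ)
  rw [abs_bval_mul] at h
  change _ ≤ _ + |Real.sin (shear (bval (ω k) * m) (x.1 + κ) + κ)| + _
  generalize shear (bval (ω k) * m) (x.1 + κ) = y at *
  have e : κ = y + κ - (x.1 + κ) - (y - (x.1 + κ)) := by ring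
  have h1 := abs_sin_sub_le (y + κ - (x.1 + κ)) (y - (x.1 + κ))
  have h2 := abs_sin_sub_le (y + κ) (x.1 + κ)
  have h3 := Real.abs_sin_le_abs (x := y - (x.1 + κ))
  rw [← e] at h1
  linarith [le_abs_self (Real.sin κ)]

variable {N : ℕ}

lemma sum_sq_displacement_le (hm : |m| ≤ 1 / 8) (s : ℝ × ℝ) :
    ∑ σ : Fin N → Bool, (1 + ((orbit (polarStep m κ) s (padded σ) N).1 - N * κ - s.1) ^ 2) ≤
      Real.exp (8 * m ^ 2 * N) * 2 ^ N := by
  have h := sum_orbit_le (N := N) (polarStep m κ)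
    (fun k x => 1 + (x.1 - k * κ - s.1) ^ 2) (c := 1 + 8 * m ^ 2) (by positivity)
    (fun k x => by
      refine le_of_eq_of_le ?_ (sq_add_shear_le hm (x.1 + κ) (x.1 - k * κ - s.1))
      simp only [polarStep, bval, if_true, Bool.false_eq_true, if_false, one_mul, neg_one_mul]
      push_cast
      ring) s le_rfl
  refine h.trans ?_
  gcongr
  have : (1 + 8 * m ^ 2) ^ N ≤ Real.exp (8 * m ^ 2) ^ N := by
    gcongr
    linarith [Real.add_one_le_exp (8 * m ^ 2)]
  rw [← Real.exp_nat_mul] at this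
  simpa [mul_comm] using this

lemma sum_radius_pow_le (hm : |m| ≤ 1 / 8) (s : ℝ × ℝ) (n : ℕ) {k : ℕ} (hk : k ≤ N) :
    ∑ σ : Fin N → Bool, ((orbit (polarStep m κ) s (padded σ) k).2 ^ 2) ^ n ≤
      Real.exp (5 * n ^ 2 * m ^ 2) ^ k * (s.2 ^ 2) ^ n * 2 ^ N := by
  refine sum_orbit_le (polarStep m κ) (fun _ x => (x.2 ^ 2) ^ n) (Real.exp_pos _).le
    (fun _ x => ?_) s hk
  have h := stretch_pow_add_le hm n (x.1 + κ)
  simp only [polarStep, bval, if_true, Bool.false_eq_true, if_false, one_mul, neg_one_mul,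
    mul_pow x.2, Real.sq_sqrt (stretch_pos hm _).le,
    Real.sq_sqrt (stretch_pos (m := -m) (by rwa [abs_neg]) _).le]
  rw [mul_pow, mul_pow]
  calc _ = (x.2 ^ 2) ^ n * (stretch m (x.1 + κ) ^ n + stretch (-m) (x.1 + κ) ^ n) := by ring
    _ ≤ (x.2 ^ 2) ^ n * (2 * Real.exp (5 * n ^ 2 * m ^ 2)) := by gcongr
    _ = _ := by ring

lemma sum_radius_inv_pow_le (hm : |m| ≤ 1 / 8) (s : ℝ × ℝ) (n : ℕ) {k : ℕ} (hk : k ≤ N) :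
    ∑ σ : Fin N → Bool, ((orbit (polarStep m κ) s (padded σ) k).2 ^ 2)⁻¹ ^ n ≤
      Real.exp (5 * n ^ 2 * m ^ 2) ^ k * (s.2 ^ 2)⁻¹ ^ n * 2 ^ N := by
  refine sum_orbit_le (polarStep m κ) (fun _ x => (x.2 ^ 2)⁻¹ ^ n) (Real.exp_pos _).le
    (fun _ x => ?_) s hk
  have h := stretch_inv_pow_add_le hm n (x.1 + κ)
  simp only [polarStep, bval, if_true, Bool.false_eq_true, if_false, one_mul, neg_one_mul,
    mul_pow x.2, Real.sq_sqrt (stretch_pos hm _).le,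
    Real.sq_sqrt (stretch_pos (m := -m) (by rwa [abs_neg]) _).le, mul_inv]
  rw [mul_pow, mul_pow]
  calc _ = (x.2 ^ 2)⁻¹ ^ n * ((stretch m (x.1 + κ))⁻¹ ^ n + (stretch (-m) (x.1 + κ))⁻¹ ^ n) := by
        ring
    _ ≤ (x.2 ^ 2)⁻¹ ^ n * (2 * Real.exp (5 * n ^ 2 * m ^ 2)) := by gcongr
    _ = _ := by ring

/-- A staircase with jumps at both ends of each interval of radius `ρ` centred at `π ℤ`. -/
def staircase (ρ x : ℝ) : ℝ := ⌊(x + ρ) / Real.pi⌋ + ⌊(x - ρ) / Real.pi⌋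

lemma staircase_mono (ρ : ℝ) : Monotone (staircase ρ) := by
  intro x y h
  have := Real.pi_pos
  unfold staircase
  gcongr

lemma staircase_add_one_le {ρ x y : ℝ} {k : ℤ} (hx : |x - k * Real.pi| < ρ) (hy : x + 2 * ρ ≤ y) :
    staircase ρ x + 1 ≤ staircase ρ y := by
  have hpi := Real.pi_pos
  have hx' := abs_lt.1 hx
  have h1 : ⌊(x + ρ) / Real.pi⌋ ≤ ⌊(y + ρ) / Real.pi⌋ :=
    Int.floor_le_floor (by gcongr; linarith)
  have h2 : ⌊(x - ρ) / Real.pi⌋ < k := by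
    rw [Int.floor_lt, div_lt_iff₀ hpi]; linarith
  have h3 : k ≤ ⌊(y - ρ) / Real.pi⌋ := by
    rw [Int.le_floor, le_div_iff₀ hpi]; linarith
  have h4 : ⌊(x + ρ) / Real.pi⌋ + ⌊(x - ρ) / Real.pi⌋ + 1 ≤
      ⌊(y + ρ) / Real.pi⌋ + ⌊(y - ρ) / Real.pi⌋ := by linarith
  unfold staircase
  exact_mod_cast h4

lemma staircase_le_sub_one {ρ x y : ℝ} {k : ℤ} (hx : |x - k * Real.pi| < ρ) (hy : y ≤ x - 2 * ρ) :
    staircase ρ y + 1 ≤ staircase ρ x := by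
  have hpi := Real.pi_pos
  have hx' := abs_lt.1 hx
  have h1 : ⌊(y - ρ) / Real.pi⌋ ≤ ⌊(x - ρ) / Real.pi⌋ :=
    Int.floor_le_floor (by gcongr; linarith)
  have h2 : ⌊(y + ρ) / Real.pi⌋ < k := by
    rw [Int.floor_lt, div_lt_iff₀ hpi]; linarith
  have h3 : k ≤ ⌊(x + ρ) / Real.pi⌋ := by
    rw [Int.le_floor, le_div_iff₀ hpi]; linarith
  have h4 : ⌊(y + ρ) / Real.pi⌋ + ⌊(y - ρ) / Real.pi⌋ + 1 ≤
      ⌊(x + ρ) / Real.pi⌋ + ⌊(x - ρ) / Real.pi⌋ := by linarith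
  unfold staircase
  exact_mod_cast h4

lemma sq_staircase_sub_le (ρ x y : ℝ) :
    (staircase ρ x - 2 * y / Real.pi) ^ 2 ≤ 8 * (1 + (x - y) ^ 2) := by
  have hpi := Real.pi_gt_three
  have h1 := Int.floor_le ((x + ρ) / Real.pi)
  have h2 := Int.lt_floor_add_one ((x + ρ) / Real.pi)
  have h3 := Int.floor_le ((x - ρ) / Real.pi)
  have h4 := Int.lt_floor_add_one ((x - ρ) / Real.pi)
  obtain ⟨u, hu⟩ : ∃ u, u = staircase ρ x - 2 * x / Real.pi := ⟨_, rfl⟩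
  have e : (x + ρ) / Real.pi + (x - ρ) / Real.pi = 2 * x / Real.pi := by ring
  have hu1 : u ≤ 0 := by rw [hu, staircase]; linarith
  have hu2 : -2 ≤ u := by rw [hu, staircase]; linarith
  have e2 : staircase ρ x - 2 * y / Real.pi = u + 2 * ((x - y) / Real.pi) := by rw [hu]; ring
  have h5 : ((x - y) / Real.pi) ^ 2 ≤ (x - y) ^ 2 := by
    rw [div_pow]
    exact div_le_self (sq_nonneg _) (by nlinarith)
  rw [e2]
  nlinarith [sq_nonneg (u - 2 * ((x - y) / Real.pi))]

/-- If the initial, current and final radii are comparable, changing a letter moves the final angle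
by a definite amount. -/
lemma two_mul_le_angle_sub {x y : ℝ × ℝ} {r R B c ρ S : ℝ} (hm0 : 0 < m) (hB : 0 < B)
    (hR : 0 < R) (hc : 0 < c) (hρ : ρ * B ^ 2 ≤ m * c ^ 2) (hx0 : 0 < x.2) (hy0 : 0 < y.2)
    (hx : x.2 ^ 2 ≤ B * R ^ 2) (hy : y.2 ^ 2 ≤ B * R ^ 2) (hr : R ^ 2 ≤ B * r ^ 2) (hS : c ≤ |S|)
    (hle : y.1 ≤ x.1) (harea : x.2 * y.2 * Real.sin (x.1 - y.1) = 2 * m * r ^ 2 * S ^ 2) :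
    2 * ρ ≤ x.1 - y.1 := by
  have hd : Real.sin (x.1 - y.1) ≤ x.1 - y.1 := Real.sin_le (by linarith)
  have hxy : x.2 * y.2 ≤ B * R ^ 2 := by nlinarith [sq_nonneg (x.2 - y.2)]
  have hS2 : c ^ 2 ≤ S ^ 2 := by rw [← sq_abs S]; gcongr
  have hd0 : 0 ≤ x.1 - y.1 := by linarith
  have h1 : 2 * m * r ^ 2 * c ^ 2 ≤ B * R ^ 2 * (x.1 - y.1) := by
    calc 2 * m * r ^ 2 * c ^ 2 ≤ 2 * m * r ^ 2 * S ^ 2 := by gcongr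
      _ = x.2 * y.2 * Real.sin (x.1 - y.1) := harea.symm
      _ ≤ x.2 * y.2 * (x.1 - y.1) := by gcongr
      _ ≤ _ := by gcongr
  have h2 : R ^ 2 * (2 * (m * c ^ 2)) ≤ R ^ 2 * (B ^ 2 * (x.1 - y.1)) := by
    calc R ^ 2 * (2 * (m * c ^ 2)) ≤ B * r ^ 2 * (2 * (m * c ^ 2)) := by gcongr
      _ = B * (2 * m * r ^ 2 * c ^ 2) := by ring
      _ ≤ B * (B * R ^ 2 * (x.1 - y.1)) := by gcongr
      _ = _ := by ring
  have h3 := le_of_mul_le_mul_left h2 (by positivity)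
  have h4 : B ^ 2 * (2 * ρ) ≤ B ^ 2 * (x.1 - y.1) := by linarith
  exact le_of_mul_le_mul_left h4 (by positivity)

lemma le_two_mul_sum_of_consecutive {f : ℕ → ℝ} (h0 : ∀ k, 0 ≤ f k)
    (h : ∀ k, 1 ≤ f k + f (k + 1)) (n : ℕ) : (n : ℝ) - 1 ≤ 2 * ∑ k ∈ Finset.range n, f k := by
  have key : ∀ n : ℕ, (n : ℝ) + f 0 + f n ≤ 2 * ∑ k ∈ Finset.range (n + 1), f k := by
    intro n
    induction n with
    | zero => simp; linarith
    | succ n ih =>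
      rw [Finset.sum_range_succ]
      push_cast
      linarith [h n]
  cases n with
  | zero => simp
  | succ n => push_cast; linarith [key n, h0 0, h0 n]

/-- The final angle seen from the direction `τ`. -/
def finalAngle (m κ : ℝ) (s : ℝ × ℝ) (τ : ℝ) (σ : Fin N → Bool) : ℝ :=
  (orbit (polarStep m κ) s (padded σ) N).1 - τ

/-- A change of letter at a time when the angle is far from `π ℤ` moves the final angle across
a jump of the staircase, unless one of the radii is atypical. -/
lemma indicator_le_influence (hm0 : 0 < m) (hm : |m| ≤ 1 / 8) {s : ℝ × ℝ} (hs : 0 < s.2)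
    {τ ρ c B : ℝ} (hc : 0 < c) (hB : 0 < B) (hρ : ρ * B ^ 2 ≤ m * c ^ 2) (n : ℕ)
    (σ : Fin N → Bool) (j : Fin N) :
    (Set.indicator {σ | ∃ k : ℤ, |finalAngle m κ s τ σ - k * Real.pi| < ρ} 1 σ : ℝ) *
        Set.indicator {x : ℝ × ℝ | c ≤ |Real.sin (x.1 + κ)|} 1
          (orbit (polarStep m κ) s (padded σ) j) ≤
      (staircase ρ (finalAngle m κ s τ σ) - staircase ρ (finalAngle m κ s τ (flipAt j σ))) *
          bval (σ j) +
        (((orbit (polarStep m κ) s (padded σ) N).2 ^ 2) ^ n +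
          ((orbit (polarStep m κ) s (padded (flipAt j σ)) N).2 ^ 2) ^ n) *
          ((s.2 ^ 2)⁻¹ ^ n * B⁻¹ ^ n) +
        ((orbit (polarStep m κ) s (padded σ) j).2 ^ 2)⁻¹ ^ n * ((s.2 ^ 2) ^ n * B⁻¹ ^ n) := by
  set Φ := finalAngle m κ s τ
  have hRj := orbit_polarStep_snd_pos (κ := κ) hm hs (padded σ) j
  have hRN := orbit_polarStep_snd_pos (κ := κ) hm hs (padded σ) N
  have hRF := orbit_polarStep_snd_pos (κ := κ) hm hs (padded (flipAt j σ)) N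
  have hcomp := orbit_update_compare (κ := κ) hm0.le hm s (padded σ) (j := j) (k := N) j.2
  have hpad : padded σ j = σ j := by simp [padded]
  set x := orbit (polarStep m κ) s (padded σ) N with hx
  set y := orbit (polarStep m κ) s (padded (flipAt j σ)) N with hy
  set z := orbit (polarStep m κ) s (padded σ) j with hz
  have hΦx : Φ σ = x.1 - τ := rfl
  have hΦy : Φ (flipAt j σ) = y.1 - τ := rfl
  have t1 : 0 ≤ (x.2 ^ 2) ^ n * ((s.2 ^ 2)⁻¹ ^ n * B⁻¹ ^ n) := by positivity
  have t2 : 0 ≤ (y.2 ^ 2) ^ n * ((s.2 ^ 2)⁻¹ ^ n * B⁻¹ ^ n) := by positivity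
  have t3 : 0 ≤ (z.2 ^ 2)⁻¹ ^ n * ((s.2 ^ 2) ^ n * B⁻¹ ^ n) := by positivity
  have big : ∀ w : ℝ, B * s.2 ^ 2 < w ^ 2 → 1 ≤ (w ^ 2) ^ n * ((s.2 ^ 2)⁻¹ ^ n * B⁻¹ ^ n) := by
    intro w hw
    rw [← mul_pow, ← mul_pow]
    refine one_le_pow₀ ?_
    rw [← mul_inv, ← div_eq_mul_inv, le_div_iff₀ (by positivity)]
    linarith
  have small : B * z.2 ^ 2 < s.2 ^ 2 → 1 ≤ (z.2 ^ 2)⁻¹ ^ n * ((s.2 ^ 2) ^ n * B⁻¹ ^ n) := by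
    intro hw
    rw [← mul_pow, ← mul_pow]
    refine one_le_pow₀ ?_
    rw [inv_mul_eq_div, ← div_eq_mul_inv, div_div, le_div_iff₀ (by positivity)]
    linarith
  have main : 0 ≤ (staircase ρ (Φ σ) - staircase ρ (Φ (flipAt j σ))) * bval (σ j) ∧
      ((∃ k : ℤ, |Φ σ - k * Real.pi| < ρ) → c ≤ |Real.sin (z.1 + κ)| →
        x.2 ^ 2 ≤ B * s.2 ^ 2 → y.2 ^ 2 ≤ B * s.2 ^ 2 → s.2 ^ 2 ≤ B * z.2 ^ 2 →
        1 ≤ (staircase ρ (Φ σ) - staircase ρ (Φ (flipAt j σ))) * bval (σ j)) := by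
    rw [hΦx, hΦy]
    rcases hb : σ j with _ | _
    · have ex : Function.update (padded σ) j false = padded σ := by
        rw [← hb, ← hpad, Function.update_eq_self]
      have ey : Function.update (padded σ) j true = padded (flipAt j σ) := by
        rw [padded_flipAt, hpad, hb, Bool.not_false]
      rw [ex, ey, ← hx, ← hy] at hcomp
      have hle := staircase_mono ρ (sub_le_sub_right hcomp.1 τ)
      simp only [bval, Bool.false_eq_true, if_false]
      refine ⟨by linarith, fun ⟨k, hk⟩ hS h1 h2 h3 => ?_⟩
      have := two_mul_le_angle_sub hm0 hB hs hc hρ hRF hRN h2 h1 h3 hS hcomp.1 hcomp.2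
      have := staircase_add_one_le hk (y := y.1 - τ) (by linarith)
      linarith
    · have ex : Function.update (padded σ) j true = padded σ := by
        rw [← hb, ← hpad, Function.update_eq_self]
      have ey : Function.update (padded σ) j false = padded (flipAt j σ) := by
        rw [padded_flipAt, hpad, hb, Bool.not_true]
      rw [ex, ey, ← hx, ← hy] at hcomp
      have hle := staircase_mono ρ (sub_le_sub_right hcomp.1 τ)
      simp only [bval, if_true]
      refine ⟨by linarith, fun ⟨k, hk⟩ hS h1 h2 h3 => ?_⟩
      have := two_mul_le_angle_sub hm0 hB hs hc hρ hRN hRF h1 h2 h3 hS hcomp.1 hcomp.2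
      have := staircase_le_sub_one hk (y := y.1 - τ) (by linarith)
      linarith
  rw [add_mul]
  by_cases hσ : ∃ k : ℤ, |Φ σ - k * Real.pi| < ρ
  · by_cases hS : c ≤ |Real.sin (z.1 + κ)|
    · rw [Set.indicator_of_mem (by exact hσ), Set.indicator_of_mem (by exact hS), Pi.one_apply,
        Pi.one_apply, one_mul]
      by_cases h1 : x.2 ^ 2 ≤ B * s.2 ^ 2
      · by_cases h2 : y.2 ^ 2 ≤ B * s.2 ^ 2
        · by_cases h3 : s.2 ^ 2 ≤ B * z.2 ^ 2
          · linarith [main.2 hσ hS h1 h2 h3]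
          · linarith [small (not_le.1 h3), main.1]
        · linarith [big _ (not_le.1 h2), main.1]
      · linarith [big _ (not_le.1 h1), main.1]
    · rw [Set.indicator_of_notMem (s := {x : ℝ × ℝ | c ≤ |Real.sin (x.1 + κ)|}) (by exact hS),
        mul_zero]
      linarith [main.1]
  · rw [Set.indicator_of_notMem (by exact hσ), zero_mul]
    linarith [main.1]

/-- Anticoncentration of the final angle modulo `π`, for the lifted polar dynamics. -/
theorem polar_anticoncentration (hm0 : 0 < m) (hm : |m| ≤ 1 / 8) {s : ℝ × ℝ} (hs : 0 < s.2)
    {τ ρ c B : ℝ} (hc : 0 < c) (hcκ : 2 * c + 2 * m < Real.sin κ) (hB : 0 < B)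
    (hρ : ρ * B ^ 2 ≤ m * c ^ 2) (n : ℕ) (hN : 0 < N) :
    ((N : ℝ) - 1) * ∑ σ : Fin N → Bool,
        Set.indicator {σ | ∃ k : ℤ, |finalAngle m κ s τ σ - k * Real.pi| < ρ} 1 σ ≤
      2 * (√N * (8 * Real.exp (8 * m ^ 2 * N) + 3) +
        N * (3 * (Real.exp (5 * n ^ 2 * m ^ 2) ^ N * B⁻¹ ^ n))) * 2 ^ N := by
  set I : (Fin N → Bool) → ℝ :=
    Set.indicator {σ | ∃ k : ℤ, |finalAngle m κ s τ σ - k * Real.pi| < ρ} 1 with hI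
  set J : ℝ × ℝ → ℝ := Set.indicator {x : ℝ × ℝ | c ≤ |Real.sin (x.1 + κ)|} 1 with hJ
  have hI0 : ∀ σ, 0 ≤ I σ := fun σ => Set.indicator_nonneg (fun _ _ => zero_le_one) _
  have hJ0 : ∀ x, 0 ≤ J x := fun σ => Set.indicator_nonneg (fun _ _ => zero_le_one) _
  set E := Real.exp (5 * n ^ 2 * m ^ 2) with hE
  have hE1 : 1 ≤ E := Real.one_le_exp (by positivity)
  have hcount : ∀ σ : Fin N → Bool,
      (N : ℝ) - 1 ≤ 2 * ∑ j : Fin N, J (orbit (polarStep m κ) s (padded σ) j) := by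
    intro σ
    rw [← Finset.sum_range fun k => J (orbit (polarStep m κ) s (padded σ) k)]
    refine le_two_mul_sum_of_consecutive (fun k => hJ0 _) (fun k => ?_) N
    have h := sin_le_consecutive (κ := κ) hm s (padded σ) k
    rw [abs_of_pos hm0] at h
    by_cases h1 : c ≤ |Real.sin ((orbit (polarStep m κ) s (padded σ) k).1 + κ)|
    · have : J (orbit (polarStep m κ) s (padded σ) k) = 1 := Set.indicator_of_mem (by exact h1) _
      linarith [hJ0 (orbit (polarStep m κ) s (padded σ) (k + 1))]
    · have h2 : c ≤ |Real.sin ((orbit (polarStep m κ) s (padded σ) (k + 1)).1 + κ)| := by linarith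
      have : J (orbit (polarStep m κ) s (padded σ) (k + 1)) = 1 :=
        Set.indicator_of_mem (by exact h2) _
      linarith [hJ0 (orbit (polarStep m κ) s (padded σ) k)]
  have hvar : ∑ σ : Fin N → Bool, (staircase ρ (finalAngle m κ s τ σ) -
      2 * (N * κ + s.1 - τ) / Real.pi) ^ 2 ≤ 8 * Real.exp (8 * m ^ 2 * N) * 2 ^ N := by
    have h := sum_sq_displacement_le (N := N) (κ := κ) hm s
    calc _ ≤ ∑ σ : Fin N → Bool,
          8 * (1 + ((orbit (polarStep m κ) s (padded σ) N).1 - N * κ - s.1) ^ 2) := by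
          refine Finset.sum_le_sum fun σ _ => (sq_staircase_sub_le _ _ _).trans_eq ?_
          rw [finalAngle]
          ring
      _ ≤ _ := by rw [← Finset.mul_sum]; linarith
  have hinf := sum_influence_le hN (fun σ => staircase ρ (finalAngle m κ s τ σ)) _ hvar
  have hs2 : (s.2 ^ 2) ^ n * (s.2 ^ 2)⁻¹ ^ n = 1 := by
    rw [← mul_pow, mul_inv_cancel₀ (by positivity), one_pow]
  have hbig := sum_radius_pow_le (N := N) (κ := κ) hm s n le_rfl
  have hBn : 0 ≤ B⁻¹ ^ n := by positivity
  have herr : ∀ j : Fin N, ∑ σ : Fin N → Bool,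
      ((((orbit (polarStep m κ) s (padded σ) N).2 ^ 2) ^ n +
          ((orbit (polarStep m κ) s (padded (flipAt j σ)) N).2 ^ 2) ^ n) *
          ((s.2 ^ 2)⁻¹ ^ n * B⁻¹ ^ n) +
        ((orbit (polarStep m κ) s (padded σ) j).2 ^ 2)⁻¹ ^ n * ((s.2 ^ 2) ^ n * B⁻¹ ^ n)) ≤
      3 * (E ^ N * B⁻¹ ^ n) * 2 ^ N := by
    intro j
    have hsmall := sum_radius_inv_pow_le (N := N) (κ := κ) hm s n j.2.le
    have hflip := sum_flipAt j fun σ : Fin N → Bool =>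
      ((orbit (polarStep m κ) s (padded σ) N).2 ^ 2) ^ n
    rw [Finset.sum_add_distrib, ← Finset.sum_mul, ← Finset.sum_mul, Finset.sum_add_distrib, hflip]
    have hEj : E ^ (j : ℕ) ≤ E ^ N := pow_le_pow_right₀ hE1 j.2.le
    calc _ ≤ (E ^ N * (s.2 ^ 2) ^ n * 2 ^ N + E ^ N * (s.2 ^ 2) ^ n * 2 ^ N) *
            ((s.2 ^ 2)⁻¹ ^ n * B⁻¹ ^ n) +
          (E ^ N * (s.2 ^ 2)⁻¹ ^ n * 2 ^ N) * ((s.2 ^ 2) ^ n * B⁻¹ ^ n) := by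
          gcongr
          refine hsmall.trans ?_
          gcongr
      _ = 3 * (E ^ N * B⁻¹ ^ n) * 2 ^ N * ((s.2 ^ 2) ^ n * (s.2 ^ 2)⁻¹ ^ n) := by ring
      _ = _ := by rw [hs2, mul_one]
  have hpt : ∑ j : Fin N, ∑ σ : Fin N → Bool, I σ * J (orbit (polarStep m κ) s (padded σ) j) ≤
      √N * (8 * Real.exp (8 * m ^ 2 * N) + 3) * 2 ^ N +
        N * (3 * (E ^ N * B⁻¹ ^ n) * 2 ^ N) := by
    refine (Finset.sum_le_sum fun j _ => Finset.sum_le_sum fun σ _ =>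
      (indicator_le_influence hm0 hm hs hc hB hρ n σ j).trans_eq (add_assoc _ _ _)).trans ?_
    simp only [Finset.sum_add_distrib] at herr ⊢
    refine add_le_add hinf ?_
    rw [← Finset.sum_add_distrib]
    refine (Finset.sum_le_sum fun j _ => herr j).trans_eq ?_
    simp
  rw [Finset.sum_comm] at hpt
  calc _ = ∑ σ, I σ * ((N : ℝ) - 1) := by rw [mul_comm, Finset.sum_mul]
    _ ≤ ∑ σ, I σ * (2 * ∑ j : Fin N, J (orbit (polarStep m κ) s (padded σ) j)) :=
        Finset.sum_le_sum fun σ _ => mul_le_mul_of_nonneg_left (hcount σ) (hI0 σ)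
    _ = 2 * ∑ σ, ∑ j : Fin N, I σ * J (orbit (polarStep m κ) s (padded σ) j) := by
        rw [Finset.mul_sum]
        refine Finset.sum_congr rfl fun σ _ => ?_
        rw [← Finset.mul_sum]
        ring
    _ ≤ _ := by linarith

end Polar

section Transfer

lemma transferB_succ (lam E : ℝ) (n : ℕ) (ω : ℕ → Bool) :
    transferB lam E (n + 1) (fun j => ω j) =
      gE lam E (bval (ω n)) * transferB lam E n (fun j => ω j) := by
  simp only [transferB, transfer]
  rw [List.ofFn_succ', List.concat_eq_append, List.reverse_append]
  simp

lemma exists_polar {x y : ℝ} (h : ¬(x = 0 ∧ y = 0)) :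
    ∃ s : ℝ × ℝ, 0 < s.2 ∧ x = s.2 * Real.cos s.1 ∧ y = s.2 * Real.sin s.1 := by
  refine ⟨(Complex.arg ⟨x, y⟩, ‖(⟨x, y⟩ : ℂ)‖), ?_, ?_, ?_⟩
  · refine norm_pos_iff.2 fun h0 => h ?_
    exact ⟨congrArg Complex.re h0, congrArg Complex.im h0⟩
  · exact (Complex.norm_mul_cos_arg ⟨x, y⟩).symm
  · exact (Complex.norm_mul_sin_arg ⟨x, y⟩).symm

lemma exists_polar_conj {κ : ℝ} (hκ : 0 < Real.sin κ) {x y : ℝ} (h : x ^ 2 + y ^ 2 = 1) :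
    ∃ s : ℝ × ℝ, 0 < s.2 ∧ x - y * Real.cos κ = s.2 * Real.cos s.1 ∧
      y * Real.sin κ = s.2 * Real.sin s.1 := by
  refine exists_polar fun ⟨h1, h2⟩ => ?_
  have hy : y = 0 := (mul_eq_zero.1 h2).resolve_right hκ.ne'
  subst hy
  have hx : x = 0 := by linarith
  subst hx
  norm_num at h

/-- In suitable coordinates, the transfer matrices act by rotations and shears. -/
lemma transferB_polar {lam E m κ : ℝ} (hE : E = 2 * Real.cos κ) (hlam : lam = m * Real.sin κ)
    (hm : |m| ≤ 1 / 8) {x y : ℝ} {s : ℝ × ℝ}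
    (h1 : x - y * Real.cos κ = s.2 * Real.cos s.1) (h2 : y * Real.sin κ = s.2 * Real.sin s.1)
    (ω : ℕ → Bool) (k : ℕ) :
    ((transferB lam E k fun j => ω j) 0 0 * x + (transferB lam E k fun j => ω j) 0 1 * y) -
        ((transferB lam E k fun j => ω j) 1 0 * x + (transferB lam E k fun j => ω j) 1 1 * y) *
          Real.cos κ =
        (orbit (polarStep m κ) s ω k).2 * Real.cos (orbit (polarStep m κ) s ω k).1 ∧
      ((transferB lam E k fun j => ω j) 1 0 * x + (transferB lam E k fun j => ω j) 1 1 * y) *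
          Real.sin κ =
        (orbit (polarStep m κ) s ω k).2 * Real.sin (orbit (polarStep m κ) s ω k).1 := by
  induction k with
  | zero => simpa [transferB, transfer, orbit] using ⟨h1, h2⟩
  | succ k ih =>
    rw [transferB_succ]
    generalize transferB lam E k (fun j => ω j) = M at *
    simp only [orbit, polarStep]
    generalize orbit (polarStep m κ) s ω k = z at *
    have hm' : |bval (ω k) * m| ≤ 1 / 8 := by rwa [abs_bval_mul]
    rw [mul_assoc, mul_assoc, sqrt_stretch_mul_cos_shear hm', sqrt_stretch_mul_sin_shear hm']
    simp only [gE, Matrix.mul_apply, Fin.sum_univ_two, Matrix.of_apply, Matrix.cons_val_zero,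
      Matrix.cons_val_one, Matrix.cons_val', Matrix.cons_val_fin_one, Real.sin_add, Real.cos_add]
    obtain ⟨i1, i2⟩ := ih
    have hs := Real.sin_sq_add_cos_sq κ
    generalize bval (ω k) = b at *
    obtain ⟨p, hp⟩ : ∃ p, p = M 0 0 * x + M 0 1 * y := ⟨_, rfl⟩
    obtain ⟨q, hq⟩ : ∃ q, q = M 1 0 * x + M 1 1 * y := ⟨_, rfl⟩
    rw [← hp, ← hq] at i1
    rw [← hq] at i2
    have key : z.2 * (Real.sin z.1 * Real.cos κ + Real.cos z.1 * Real.sin κ) = p * Real.sin κ := by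
      linear_combination (-Real.cos κ) * i2 - Real.sin κ * i1
    constructor
    · subst hE hlam
      linear_combination (-b * m) * key.symm + Real.cos κ * i1 - Real.sin κ * i2 + q * hs -
        Real.cos κ * hp + hq + b * m * Real.sin κ * hp
    · linear_combination key.symm - Real.sin κ * hp

lemma abs_sin_sub_lt_of_dist_lt {x r T : ℝ}
    (h : dist (x : AddCircle (2 * Real.pi)) (T : AddCircle (2 * Real.pi)) < r) :
    |Real.sin (x - T)| ≤ r := by
  rw [dist_eq_norm, ← AddCircle.coe_sub, AddCircle.norm_eq] at h
  set k := round ((2 * Real.pi)⁻¹ * (x - T))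
  rw [← Real.sin_sub_int_mul_two_pi (x - T) k]
  exact Real.abs_sin_le_abs.trans h.le

lemma exists_int_mul_pi_of_abs_sin_le {x e : ℝ} (h : |Real.sin x| ≤ e) :
    ∃ k : ℤ, |x - k * Real.pi| ≤ Real.pi / 2 * e := by
  have hpi := Real.pi_pos
  refine ⟨round (x / Real.pi), ?_⟩
  have h1 : |x - round (x / Real.pi) * Real.pi| ≤ Real.pi / 2 := by
    have := abs_sub_round (x / Real.pi)
    have e : x - round (x / Real.pi) * Real.pi = (x / Real.pi - round (x / Real.pi)) * Real.pi := by
      field_simp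
    rw [e, abs_mul, abs_of_pos hpi]
    nlinarith
  have h2 := Real.mul_abs_le_abs_sin h1
  rw [Real.sin_sub_int_mul_pi, abs_mul, abs_neg_one_zpow, one_mul] at h2
  calc _ = Real.pi / 2 * (2 / Real.pi * |x - round (x / Real.pi) * Real.pi|) := by field_simp
    _ ≤ _ := by gcongr; linarith

lemma mul_norm_sq_le {c d x y : ℝ} (hc : |c| ≤ 1 - d) :
    d * (x ^ 2 + y ^ 2) ≤ x ^ 2 + y ^ 2 - 2 * c * (x * y) := by
  have h := abs_le.1 hc
  rcases le_total 0 (x * y) with hxy | hxy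
  · nlinarith [sq_nonneg (x - y)]
  · nlinarith [sq_nonneg (x + y)]

/-- If the image of `θ` is close to `T`, then the final angle in adapted coordinates is close to
the adapted angle of `T`, up to a multiple of `π`. -/
lemma exists_int_of_dist_tauC_lt {κ d r T θ : ℝ} {g : Matrix (Fin 2) (Fin 2) ℝ} {z w : ℝ × ℝ}
    (hd : 0 < d) (hr : 0 < r) (hκ : 0 < Real.sin κ) (hc : |Real.cos κ| ≤ 1 - d)
    (h : dist (tauC g θ) (T : AddCircle (2 * Real.pi)) < r) (hz : 0 < z.2) (hw : 0 < w.2)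
    (z1 : (g 0 0 * Real.cos θ + g 0 1 * Real.sin θ) -
      (g 1 0 * Real.cos θ + g 1 1 * Real.sin θ) * Real.cos κ = z.2 * Real.cos z.1)
    (z2 : (g 1 0 * Real.cos θ + g 1 1 * Real.sin θ) * Real.sin κ = z.2 * Real.sin z.1)
    (w1 : Real.cos T - Real.sin T * Real.cos κ = w.2 * Real.cos w.1)
    (w2 : Real.sin T * Real.sin κ = w.2 * Real.sin w.1) :
    ∃ k : ℤ, |z.1 - w.1 - k * Real.pi| < 2 * r / d := by
  unfold tauC at h
  set x := g 0 0 * Real.cos θ + g 0 1 * Real.sin θ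
  set y := g 1 0 * Real.cos θ + g 1 1 * Real.sin θ
  have hsin := abs_sin_sub_lt_of_dist_lt h
  set ζ : ℂ := (x : ℝ) + Complex.I * (y : ℝ) with hζ
  have hre : ‖ζ‖ * Real.cos ζ.arg = x := by
    rw [Complex.norm_mul_cos_arg]; simp [hζ]
  have him : ‖ζ‖ * Real.sin ζ.arg = y := by
    rw [Complex.norm_mul_sin_arg]; simp [hζ]
  have hn : ‖ζ‖ ^ 2 = x ^ 2 + y ^ 2 := by
    rw [← hre, ← him]
    linear_combination (-‖ζ‖ ^ 2) * Real.sin_sq_add_cos_sq ζ.arg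
  have hκ2 := Real.sin_sq_add_cos_sq κ
  have hz2 : d * ‖ζ‖ ^ 2 ≤ z.2 ^ 2 := by
    have e : z.2 ^ 2 = x ^ 2 + y ^ 2 - 2 * Real.cos κ * (x * y) := by
      have := Real.sin_sq_add_cos_sq z.1
      calc z.2 ^ 2 = (z.2 * Real.cos z.1) ^ 2 + (z.2 * Real.sin z.1) ^ 2 := by
            linear_combination (-z.2 ^ 2) * this
        _ = _ := by rw [← z1, ← z2]; linear_combination y ^ 2 * hκ2
    rw [e, hn]
    exact mul_norm_sq_le hc
  have hw2 : d ≤ w.2 ^ 2 := by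
    have e : w.2 ^ 2 = Real.cos T ^ 2 + Real.sin T ^ 2 -
        2 * Real.cos κ * (Real.cos T * Real.sin T) := by
      have := Real.sin_sq_add_cos_sq w.1
      calc w.2 ^ 2 = (w.2 * Real.cos w.1) ^ 2 + (w.2 * Real.sin w.1) ^ 2 := by
            linear_combination (-w.2 ^ 2) * this
        _ = _ := by rw [← w1, ← w2]; linear_combination Real.sin T ^ 2 * hκ2
    have := mul_norm_sq_le (x := Real.cos T) (y := Real.sin T) hc
    rw [e]
    rwa [add_comm (Real.cos T ^ 2), Real.sin_sq_add_cos_sq, mul_one,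
      ← Real.sin_sq_add_cos_sq T, add_comm (Real.sin T ^ 2)] at this
  have harea : z.2 * w.2 * Real.sin (z.1 - w.1) =
      Real.sin κ * (‖ζ‖ * Real.sin (ζ.arg - T)) := by
    rw [Real.sin_sub, Real.sin_sub]
    calc _ = (z.2 * Real.sin z.1) * (w.2 * Real.cos w.1) -
          (z.2 * Real.cos z.1) * (w.2 * Real.sin w.1) := by ring
      _ = Real.sin κ * ((‖ζ‖ * Real.sin ζ.arg) * Real.cos T -
          (‖ζ‖ * Real.cos ζ.arg) * Real.sin T) := by rw [← z1, ← z2, ← w1, ← w2, hre, him]; ring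
      _ = _ := by ring
  have hprod : d * ‖ζ‖ ≤ z.2 * w.2 := by
    refine le_of_sq_le_sq ?_ (by positivity)
    calc (d * ‖ζ‖) ^ 2 = (d * ‖ζ‖ ^ 2) * d := by ring
      _ ≤ z.2 ^ 2 * w.2 ^ 2 := by gcongr
      _ = _ := by ring
  have hfin : |Real.sin (z.1 - w.1)| ≤ r / d := by
    have h1 : z.2 * w.2 * |Real.sin (z.1 - w.1)| ≤ z.2 * w.2 * (r / d) := by
      calc z.2 * w.2 * |Real.sin (z.1 - w.1)| = |z.2 * w.2 * Real.sin (z.1 - w.1)| := by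
            rw [abs_mul, abs_of_pos (mul_pos hz hw)]
        _ = Real.sin κ * (‖ζ‖ * |Real.sin (ζ.arg - T)|) := by
            rw [harea, abs_mul, abs_mul, abs_of_pos hκ, abs_norm]
        _ ≤ 1 * (‖ζ‖ * r) := by
            gcongr
            exact Real.sin_le_one κ
        _ = d * ‖ζ‖ * (r / d) := by field_simp
        _ ≤ _ := by gcongr
    exact le_of_mul_le_mul_left h1 (mul_pos hz hw)
  obtain ⟨k, hk⟩ := exists_int_mul_pi_of_abs_sin_le hfin
  refine ⟨k, hk.trans_lt ?_⟩
  rw [mul_div_assoc]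
  have := Real.pi_lt_four
  have hrd : 0 < r / d := by positivity
  nlinarith

lemma mes_le_sum_indicator {n : ℕ} {S T : Set (Fin n → Bool)} (h : S ⊆ T) :
    mes S ≤ (∑ σ, T.indicator (1 : (Fin n → Bool) → ℝ) σ) / 2 ^ n := by
  classical
  unfold mes
  gcongr
  rw [Finset.card_filter]
  push_cast
  refine Finset.sum_le_sum fun σ _ => ?_
  by_cases hS : σ ∈ S
  · simp [hS, h hS]
  · rw [if_neg hS]
    exact Set.indicator_nonneg (fun _ _ => zero_le_one) σ

lemma exists_rotation_angle {d E : ℝ} (hd0 : 0 < d) (hd1 : d < 1 / 2) (hE : |E| < 2 - 2 * d) :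
    ∃ κ, E = 2 * Real.cos κ ∧ |Real.cos κ| ≤ 1 - d ∧ d ≤ Real.sin κ := by
  have hcE := abs_lt.1 hE
  have hcos : Real.cos (Real.arccos (E / 2)) = E / 2 := by
    rw [Real.cos_arccos (by linarith) (by linarith)]
  have hcos_abs : |E / 2| ≤ 1 - d := by
    rw [abs_div, abs_two]; linarith
  refine ⟨Real.arccos (E / 2), by rw [hcos]; ring, by rwa [hcos], ?_⟩
  rw [Real.sin_arccos]
  refine Real.le_sqrt_of_sq_le ?_
  have h2 : (E / 2) ^ 2 ≤ (1 - d) ^ 2 := by rw [← sq_abs]; gcongr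
  nlinarith

lemma exp_moment_tail_le {K L M : ℝ} {N : ℕ} (hL : 1 ≤ L) (hK : 0 < K) (hM : M * N ≤ K) :
    ∃ n : ℕ, Real.exp (5 * n ^ 2 * M) ^ N * (Real.exp ((20 * K + 1) * √L))⁻¹ ^ n ≤
      Real.exp (-L) := by
  have hq1 : 1 ≤ √L := Real.one_le_sqrt.2 hL
  have hqq : √L ^ 2 = L := Real.sq_sqrt (by linarith)
  refine ⟨⌈√L⌉₊, ?_⟩
  have hnge := Nat.le_ceil √L
  have hnlt := Nat.ceil_lt_add_one (a := √L) (by positivity)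
  generalize ⌈√L⌉₊ = n at *
  have hn2 : (n : ℝ) ^ 2 ≤ 4 * L := by
    calc (n : ℝ) ^ 2 ≤ (2 * √L) ^ 2 := by gcongr; linarith
      _ = 4 * L := by rw [mul_pow, hqq]; norm_num
  have e1 : (n : ℝ) ^ 2 * (M * N) ≤ 4 * L * K := by
    calc (n : ℝ) ^ 2 * (M * N) ≤ n ^ 2 * K := by gcongr
      _ ≤ 4 * L * K := by gcongr
  have e2 : (20 * K + 1) * L ≤ n * ((20 * K + 1) * √L) := by
    calc (20 * K + 1) * L = √L * ((20 * K + 1) * √L) := by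
          linear_combination (-(20 * K + 1)) * hqq
      _ ≤ _ := by gcongr
  rw [← Real.exp_neg, ← Real.exp_nat_mul, ← Real.exp_nat_mul, ← Real.exp_add, Real.exp_le_exp]
  linarith

lemma exp_threshold_le {A C D x : ℝ} (hD : 0 < D) (hC : 2 * A + D ≤ C) (hx : 1 ≤ x) :
    Real.exp (-C * x) * Real.exp (A * x) ^ 2 ≤ D⁻¹ := by
  rw [← Real.exp_nat_mul, ← Real.exp_add]
  calc _ ≤ Real.exp (-D) := by
        gcongr
        push_cast
        nlinarith
    _ ≤ D⁻¹ := by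
        rw [Real.exp_neg]
        gcongr
        linarith [Real.add_one_le_exp D]

lemma le_of_sub_one_mul_le {M P S X Z V δ Q : ℝ} (hM : 2 ≤ M) (hP : 0 ≤ P) (hδ : 0 ≤ δ)
    (hQ : 0 ≤ Q) (hX : 0 ≤ X) (hXV : X ≤ V) (hS : S ≤ δ * M) (hZ : Z ≤ δ)
    (h : (M - 1) * P ≤ 2 * (S * X + M * (3 * Z)) * Q) : P ≤ 4 * (V + 3) * δ * Q := by
  refine le_of_mul_le_mul_left ?_ (by linarith : 0 < M)
  calc M * P ≤ 2 * ((M - 1) * P) := by nlinarith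
    _ ≤ 2 * (2 * (S * X + M * (3 * Z)) * Q) := by gcongr
    _ ≤ 2 * (2 * (δ * M * V + M * (3 * δ)) * Q) := by gcongr
    _ = _ := by ring

end Transfer

/-- **Lemma 3.** For small `λ`, `N = ⌈λ⁻²⌉`, `δ₀ < |E| < 2 - δ₀`, any `θ` and any `t`,
`mes[ε : |τ_{M_N(E;ε)}(θ) - t| < λ e^{-C |log λ|^{1/2}}] ≤ C λ`. -/
theorem tau_anticoncentration
    (δ₀ : ℝ) (hδ₀ : 0 < δ₀) (hδ₀' : δ₀ < 1) :
    ∃ C lam0 : ℝ, 0 < C ∧ 0 < lam0 ∧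
      ∀ lam : ℝ, 0 < lam → lam < lam0 →
        ∀ E : ℝ, δ₀ < |E| → |E| < 2 - δ₀ →
          ∀ (θ : ℝ) (t : AddCircle (2 * Real.pi)),
            mes {σ : Fin (⌈(lam ^ 2)⁻¹⌉₊) → Bool |
                dist (tauC (transferB lam E (⌈(lam ^ 2)⁻¹⌉₊) σ) θ) t <
                  lam * Real.exp (-C * Real.sqrt |Real.log lam|)} ≤
              C * lam := by
  obtain ⟨d, hd⟩ : ∃ d, d = δ₀ / 2 := ⟨_, rfl⟩
  have hd0 : 0 < d := by linarith
  have hd1 : d < 1 / 2 := by linarith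
  obtain ⟨K, hK⟩ : ∃ K, K = 2 / d ^ 2 := ⟨_, rfl⟩
  have hK0 : 0 < K := by rw [hK]; positivity
  obtain ⟨V, hV⟩ : ∃ V, V = 8 * Real.exp (8 * K) + 3 := ⟨_, rfl⟩
  have hV0 : 0 < V := by rw [hV]; positivity
  obtain ⟨A, hA⟩ : ∃ A, A = 20 * K + 1 := ⟨_, rfl⟩
  have hA0 : 0 < A := by linarith
  obtain ⟨C, hC⟩ : ∃ C, C = 2 * A + 32 / d ^ 3 + 4 * (V + 3) := ⟨_, rfl⟩
  have h32 : 0 < 32 / d ^ 3 := by positivity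
  refine ⟨C, d ^ 2 / 8, by linarith, by positivity, ?_⟩
  intro lam hlam hlam' E _ hE θ t
  obtain ⟨T, rfl⟩ := QuotientAddGroup.mk_surjective t
  have hlam1 : lam < 1 / 32 := by nlinarith
  obtain ⟨κ, hκ, hcos_abs, hsind⟩ := exists_rotation_angle hd0 hd1 (by linarith : |E| < 2 - 2 * d)
  have hsin1 := Real.sin_le_one κ
  have hsin : 0 < Real.sin κ := by linarith
  obtain ⟨m, hm⟩ : ∃ m, m = lam / Real.sin κ := ⟨_, rfl⟩
  have hlm : lam = m * Real.sin κ := by rw [hm]; field_simp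
  have hm0 : 0 < m := by rw [hm]; positivity
  have hmd : m ≤ lam / d := by rw [hm]; gcongr
  have hmd' : m < d / 8 := hmd.trans_lt (by rw [div_lt_iff₀ hd0]; nlinarith)
  have hml : lam ≤ m := by nlinarith
  have hm8 : |m| ≤ 1 / 8 := by rw [abs_of_pos hm0]; linarith
  obtain ⟨L, hL⟩ : ∃ L, L = |Real.log lam| := ⟨_, rfl⟩
  have hLlog : L = -Real.log lam := by
    rw [hL, abs_of_nonpos (Real.log_nonpos hlam.le (by linarith))]
  have hexpL : Real.exp (-L) = lam := by rw [hLlog, neg_neg, Real.exp_log hlam]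
  have hL1 : 1 ≤ L := by
    have : lam ≤ Real.exp (-1) := by
      have h3 := Real.exp_one_lt_d9
      rw [Real.exp_neg, le_inv_comm₀ hlam (Real.exp_pos 1)]
      refine h3.le.trans ?_
      rw [le_inv_comm₀ (by norm_num) hlam]
      norm_num
      linarith
    rw [← hexpL, Real.exp_le_exp] at this
    linarith
  have hq1 : 1 ≤ √L := Real.one_le_sqrt.2 hL1
  obtain ⟨N, hN⟩ : ∃ N, N = ⌈(lam ^ 2)⁻¹⌉₊ := ⟨_, rfl⟩
  have hNge : (lam ^ 2)⁻¹ ≤ N := by rw [hN]; exact Nat.le_ceil _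
  have hlam2 : 2 ≤ (lam ^ 2)⁻¹ := by
    rw [le_inv_comm₀ (by norm_num) (by positivity)]
    nlinarith
  have hNle : (N : ℝ) ≤ 2 * (lam ^ 2)⁻¹ := by
    have := Nat.ceil_lt_add_one (a := (lam ^ 2)⁻¹) (by positivity)
    rw [← hN] at this
    linarith
  have hN2 : (2 : ℝ) ≤ N := hlam2.trans hNge
  have hN0 : 0 < N := by
    have : (0 : ℝ) < N := by linarith
    exact_mod_cast this
  have hmN : m ^ 2 * N ≤ K := by
    calc m ^ 2 * N ≤ (lam / d) ^ 2 * (2 * (lam ^ 2)⁻¹) := by gcongr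
      _ = K := by rw [hK]; field_simp
  obtain ⟨B, hB⟩ : ∃ B, B = Real.exp (A * √L) := ⟨_, rfl⟩
  have hB0 : 0 < B := by rw [hB]; positivity
  obtain ⟨n, htail⟩ := exp_moment_tail_le hL1 hK0 hmN
  rw [← hA, ← hB, hexpL] at htail
  obtain ⟨r, hr⟩ : ∃ r, r = lam * Real.exp (-C * √L) := ⟨_, rfl⟩
  have hr0 : 0 < r := by rw [hr]; positivity
  have hρ : 2 * r / d * B ^ 2 ≤ m * (d / 4) ^ 2 := by
    have e1 : Real.exp (-C * √L) * B ^ 2 ≤ (32 / d ^ 3)⁻¹ := by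
      rw [hB]
      exact exp_threshold_le h32 (by linarith) hq1
    rw [inv_div] at e1
    calc 2 * r / d * B ^ 2 = 2 * lam / d * (Real.exp (-C * √L) * B ^ 2) := by rw [hr]; ring
      _ ≤ 2 * lam / d * (d ^ 3 / 32) := by gcongr
      _ = lam * (d / 4) ^ 2 := by field_simp; norm_num
      _ ≤ _ := by gcongr
  obtain ⟨s, hs0, hs1, hs2⟩ := exists_polar_conj hsin (Real.cos_sq_add_sin_sq θ)
  obtain ⟨w, hw0, hw1, hw2⟩ := exists_polar_conj hsin (Real.cos_sq_add_sin_sq T)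
  rw [← hN, ← hL, ← hr]
  have hsub : {σ : Fin N → Bool | dist (tauC (transferB lam E N σ) θ)
      (T : AddCircle (2 * Real.pi)) < r} ⊆
      {σ | ∃ k : ℤ, |finalAngle m κ s w.1 σ - k * Real.pi| < 2 * r / d} := by
    intro σ hσ
    obtain ⟨z1, z2⟩ := transferB_polar hκ hlm hm8 hs1 hs2
      (padded σ) N
    have hpad : (fun j : Fin N => padded σ j) = σ := by
      funext j
      simp [padded]
    rw [hpad] at z1 z2
    exact exists_int_of_dist_tauC_lt hd0 hr0 hsin hcos_abs hσ
      (orbit_polarStep_snd_pos hm8 hs0 _ _) hw0 z1 z2 hw1 hw2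
  refine (mes_le_sum_indicator hsub).trans ?_
  rw [div_le_iff₀ (by positivity)]
  have hmain := polar_anticoncentration (κ := κ) (τ := w.1) hm0 hm8 hs0 (c := d / 4)
    (by positivity) (by linarith) hB0 hρ n hN0
  have hVle : 8 * Real.exp (8 * m ^ 2 * N) + 3 ≤ V := by
    rw [hV, mul_assoc 8 (m ^ 2)]
    gcongr
  have hsqrt : √N ≤ lam * N := by
    have h1 : 1 ≤ lam * √N := by
      have : lam⁻¹ ≤ √N := by
        refine Real.le_sqrt_of_sq_le ?_
        rwa [inv_pow]
      rwa [inv_le_iff_one_le_mul₀' hlam] at this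
    calc √N ≤ lam * √N * √N := le_mul_of_one_le_left (Real.sqrt_nonneg _) h1
      _ = lam * N := by rw [mul_assoc, Real.mul_self_sqrt (by positivity)]
  refine (le_of_sub_one_mul_le hN2
    (Finset.sum_nonneg fun σ _ => Set.indicator_nonneg (fun _ _ => zero_le_one) σ)
    hlam.le (by positivity) (by positivity) hVle hsqrt htail hmain).trans ?_
  gcongr
  linarith
end
end
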